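/- arXiv:math/0408372 — 8 statements merged into one kernel-verified Lean document; each statement's English description precedes it below -/
import Mathlib

section
/- Let α, β, μ > 0 with α ≠ β and set μ_N = μ/N. For every Schwartz function f ∈ S(ℝ) there exists a constant C = C(f, α, β, μ) > 0 such that for every integer N ≥ 2 and every z ∈ H_N one has |L_N R_f(z)| ≤ C/N. -/
open scoped BigOperators
open Filter

/-- Indicator sequence of `{j}` in `ℤ → ℝ`. -/
noncomputable def eZ (j : ℤ) : ℤ → ℝ := fun k => if k = j then 1 else 0

/-- The sequence `e_{l+1} + ⋯ + e_k` (indicator of `(l, k]`). -/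
noncomputable def eBlock (l k : ℤ) : ℤ → ℝ := fun m => if l < m ∧ m ≤ k then 1 else 0

/-- The state space `H_N`: nonincreasing `z : ℤ → ℝ` with values in `{l/N : 0 ≤ l ≤ N}`,
tending to `1` at `-∞` and to `0` at `+∞`. -/
def HN (N : ℕ) : Set (ℤ → ℝ) :=
  {z | Antitone z ∧
       (∀ k : ℤ, ∃ l : ℕ, l ≤ N ∧ z k = (l : ℝ) / N) ∧
       Tendsto z atBot (nhds 1) ∧
       Tendsto z atTop (nhds 0)}

/-- `R_f(z) = (1/N) ∑_{k ∈ ℤ} f(k/N) z_k`. -/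
noncomputable def Rf (N : ℕ) (f : SchwartzMap ℝ ℝ) (z : ℤ → ℝ) : ℝ :=
  (1 / (N : ℝ)) * ∑' k : ℤ, f ((k : ℝ) / N) * z k

/-- The generator `L_N` with jump rates `α` (right), `β` (left) and interaction rate `μN`,
applied to a function `F` of the configuration `z`. -/
noncomputable def LN (N : ℕ) (α β μN : ℝ) (F : (ℤ → ℝ) → ℝ) (z : ℤ → ℝ) : ℝ :=
  (N : ℝ) * ∑' k : ℤ,
      ((F (z + ((N : ℝ))⁻¹ • eZ k) - F z) * α * (z (k - 1) - z k) +
       (F (z - ((N : ℝ))⁻¹ • eZ k) - F z) * β * (z k - z (k + 1))) +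
  (N : ℝ) * μN * ∑' l : ℤ, ∑' k : ℤ,
      if l < k then
        (F (z - ((N : ℝ))⁻¹ • eBlock l k) - F z) * (z k - z (k + 1)) * (z l - z (l + 1))
      else 0

/-- The jumps of a configuration in `H_N` sum to one. -/
lemma hasSum_sub_succ {z : ℤ → ℝ} (hz : Antitone z) (hbot : Tendsto z atBot (nhds 1))
    (htop : Tendsto z atTop (nhds 0)) : HasSum (fun k => z k - z (k + 1)) 1 := by
  have h1 : HasSum (fun n : ℕ => z (n : ℤ) - z ((n : ℤ) + 1)) (z 0) := by
    rw [hasSum_iff_tendsto_nat_of_nonneg (fun n => sub_nonneg.2 (hz (by omega)))]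
    have hs (n : ℕ) : ∑ i ∈ Finset.range n, (z (i : ℤ) - z ((i : ℤ) + 1)) = z 0 - z n := by
      have := Finset.sum_range_sub' (fun i : ℕ => z (i : ℤ)) n
      simpa using this
    simp only [hs]
    have := (htop.comp tendsto_natCast_atTop_atTop).const_sub (z 0)
    simpa using this
  have h2 : HasSum (fun n : ℕ => z (-((n : ℤ) + 1)) - z (-((n : ℤ) + 1) + 1)) (1 - z 0) := by
    rw [hasSum_iff_tendsto_nat_of_nonneg (fun n => sub_nonneg.2 (hz (by omega)))]
    have hs (n : ℕ) : ∑ i ∈ Finset.range n, (z (-((i : ℤ) + 1)) - z (-((i : ℤ) + 1) + 1))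
        = z (-(n : ℤ)) - z 0 := by
      have := Finset.sum_range_sub (fun i : ℕ => z (-(i : ℤ))) n
      simpa using this
    simp only [hs]
    have ht : Tendsto (fun n : ℕ => -(n : ℤ)) atTop atBot :=
      tendsto_neg_atTop_atBot.comp tendsto_natCast_atTop_atTop
    exact (hbot.comp ht).sub_const (z 0)
  have := HasSum.of_nat_of_neg_add_one (f := fun k : ℤ => z k - z (k + 1)) h1 h2
  simpa using this

lemma summable_inv_one_add_int_sq : Summable fun q : ℤ => (1 + (q : ℝ) ^ 2)⁻¹ := by
  have h : Summable fun q : ℤ => 1 / (q : ℝ) ^ 2 :=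
    Real.summable_one_div_int_pow.2 (by norm_num)
  refine Summable.of_norm_bounded_eventually h ?_
  have h0 : ∀ᶠ q : ℤ in cofinite, q ≠ 0 := by
    simpa using (Set.finite_singleton (0 : ℤ)).compl_mem_cofinite
  filter_upwards [h0] with q hq
  have : (0 : ℝ) < (q : ℝ) ^ 2 := by positivity
  rw [Real.norm_of_nonneg (by positivity), one_div]
  gcongr
  linarith

/-- Riemann sums with mesh `1 / N` of the absolute value of a Schwartz function are bounded
uniformly in `N`. -/
lemma SchwartzMap.exists_riemannSum_bound (f : SchwartzMap ℝ ℝ) :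
    ∃ K : ℝ, 0 ≤ K ∧ ∀ N : ℕ, 0 < N →
      Summable (fun k : ℤ => |f ((k : ℝ) / N)|) ∧ ∑' k : ℤ, |f ((k : ℝ) / N)| ≤ N * K := by
  obtain ⟨A, hA⟩ := f.decay 0 0
  obtain ⟨B, hB⟩ := f.decay 2 0
  have hf (x : ℝ) : (1 + x ^ 2) * |f x| ≤ A + B := by
    have h1 := hA.2 x
    have h2 := hB.2 x
    simp only [pow_zero, one_mul, norm_iteratedFDeriv_zero, Real.norm_eq_abs, sq_abs] at h1 h2
    linarith
  have hAB : 0 < A + B := add_pos hA.1 hB.1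
  set g : ℤ → ℝ := fun q => 3 * (A + B) * (1 + (q : ℝ) ^ 2)⁻¹ with hg
  have hgs : Summable g := summable_inv_one_add_int_sq.mul_left _
  refine ⟨∑' q, g q, tsum_nonneg fun q => by simp only [hg]; positivity, fun N hN => ?_⟩
  have : NeZero N := ⟨hN.ne'⟩
  have hN' : (0 : ℝ) < N := by exact_mod_cast hN
  have hG : HasSum (fun p : ℤ × Fin N => g p.1) (N * ∑' q, g q) := by
    have hs : Summable (fun p : ℤ × Fin N => g p.1) := by
      have := Summable.mul_of_nonneg hgs (Summable.of_finite :
        Summable fun _ : Fin N => (1 : ℝ)) (fun q => by simp only [hg, Pi.zero_apply]; positivity)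
        (fun _ => zero_le_one)
      simpa using this
    convert hs.hasSum using 1
    rw [hs.tsum_prod]
    simp [tsum_mul_left]
  have hH : HasSum (fun k : ℤ => g (k / N)) (N * ∑' q, g q) := by
    have := (Int.divModEquiv N).hasSum_iff.2 hG
    exact this
  have hle (k : ℤ) : |f ((k : ℝ) / N)| ≤ g (k / N) := by
    have h1 : ((k / (N : ℤ) : ℤ) : ℝ) ≤ (k : ℝ) / N := by
      rw [le_div_iff₀ hN']
      exact_mod_cast Int.ediv_mul_le k (by omega)
    have h2 : (k : ℝ) / N ≤ ((k / (N : ℤ) : ℤ) : ℝ) + 1 := by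
      rw [div_le_iff₀ hN']
      exact_mod_cast (Int.lt_ediv_add_one_mul_self k (by omega)).le
    simp only [hg]
    generalize ((k / (N : ℤ) : ℤ) : ℝ) = q at *
    generalize (k : ℝ) / N = x at *
    rw [← div_eq_mul_inv, le_div_iff₀ (by positivity)]
    have h3 : 1 + q ^ 2 ≤ 3 * (1 + x ^ 2) := by nlinarith [sq_nonneg (2 * x - q), sq_nonneg x]
    nlinarith [hf x, abs_nonneg (f x), mul_le_mul_of_nonneg_right h3 (abs_nonneg (f x))]
  have hs := Summable.of_nonneg_of_le (fun k => abs_nonneg _) hle hH.summable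
  exact ⟨hs, (hs.tsum_le_tsum hle hH.summable).trans_eq hH.tsum_eq⟩

/-- `R_f` is affine along bounded perturbations. -/
lemma Rf_add_sub {N : ℕ} {f : SchwartzMap ℝ ℝ} (hs : Summable fun k : ℤ => |f ((k : ℝ) / N)|)
    {z h : ℤ → ℝ} {a b : ℝ} (hz : ∀ k, |z k| ≤ a) (hh : ∀ k, |h k| ≤ b) :
    Rf N f (z + h) - Rf N f z = 1 / (N : ℝ) * ∑' k : ℤ, f ((k : ℝ) / N) * h k := by
  have key {w : ℤ → ℝ} {c : ℝ} (hw : ∀ k, |w k| ≤ c) :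
      Summable fun k : ℤ => f ((k : ℝ) / N) * w k := by
    refine Summable.of_norm_bounded (hs.mul_right c) fun k => ?_
    rw [norm_mul]
    exact mul_le_mul_of_nonneg_left (hw k) (abs_nonneg _)
  simp only [Rf, Pi.add_apply, mul_add]
  rw [(key hz).tsum_add (key hh)]
  ring

lemma abs_Rf_add_smul_eZ_sub_le {N : ℕ} {f : SchwartzMap ℝ ℝ} {A : ℝ} (hA : ∀ x, |f x| ≤ A)
    (hs : Summable fun k : ℤ => |f ((k : ℝ) / N)|) {z : ℤ → ℝ} {a : ℝ} (hz : ∀ k, |z k| ≤ a)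
    (c : ℝ) (j : ℤ) :
    |Rf N f (z + c • eZ j) - Rf N f z| ≤ (N : ℝ)⁻¹ * (A * |c|) := by
  rw [Rf_add_sub hs hz (b := |c|) (fun k => ?_), tsum_eq_single j (fun k hk => by simp [eZ, hk]),
    abs_mul, abs_mul, one_div, abs_of_nonneg (by positivity : 0 ≤ (N : ℝ)⁻¹)]
  · simp only [eZ, Pi.smul_apply, if_true, smul_eq_mul, mul_one]
    gcongr
    exact hA _
  · by_cases h : k = j <;> simp [eZ, h]

lemma abs_Rf_sub_smul_eBlock_sub_le {N : ℕ} {f : SchwartzMap ℝ ℝ} {K : ℝ} (hN : 0 < N)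
    (hs : Summable fun k : ℤ => |f ((k : ℝ) / N)|)
    (hK : ∑' k : ℤ, |f ((k : ℝ) / N)| ≤ N * K) {z : ℤ → ℝ} {a : ℝ} (hz : ∀ k, |z k| ≤ a)
    (l k : ℤ) :
    |Rf N f (z - (N : ℝ)⁻¹ • eBlock l k) - Rf N f z| ≤ K / N := by
  have hN' : (0 : ℝ) < N := by exact_mod_cast hN
  have hb (m : ℤ) : |(-((N : ℝ)⁻¹ • eBlock l k)) m| ≤ (N : ℝ)⁻¹ := by
    by_cases h : l < m ∧ m ≤ k <;> simp [eBlock, h]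
  rw [sub_eq_add_neg z, Rf_add_sub hs hz hb, abs_mul, one_div,
    abs_of_nonneg (by positivity : 0 ≤ (N : ℝ)⁻¹)]
  have h1 : |∑' m : ℤ, f ((m : ℝ) / N) * (-((N : ℝ)⁻¹ • eBlock l k)) m|
      ≤ (∑' m : ℤ, |f ((m : ℝ) / N)|) * (N : ℝ)⁻¹ := by
    rw [← Real.norm_eq_abs]
    refine tsum_of_norm_bounded (hs.hasSum.mul_right _) fun m => ?_
    rw [norm_mul]
    exact mul_le_mul_of_nonneg_left (hb m) (abs_nonneg _)
  calc (N : ℝ)⁻¹ * _ ≤ (N : ℝ)⁻¹ * ((N * K) * (N : ℝ)⁻¹) := by gcongr; exact h1.trans (by gcongr)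
    _ = K / N := by field_simp

/-- for `α ≠ β`, `μ_N = μ/N`, the bound `|L_N R_f(z)| ≤ C/N` holds uniformly
in `N ≥ 2` and `z ∈ H_N`. -/
theorem statement0 (α β μ : ℝ) (hα : 0 < α) (hβ : 0 < β) (hμ : 0 < μ) (hαβ : α ≠ β)
    (f : SchwartzMap ℝ ℝ) :
    ∃ C : ℝ, 0 < C ∧ ∀ N : ℕ, 2 ≤ N → ∀ z ∈ HN N,
      |LN N α β (μ / N) (Rf N f) z| ≤ C / N := by
  obtain ⟨A, hA0, hA⟩ := f.decay 0 0
  replace hA (x : ℝ) : |f x| ≤ A := by simpa using hA x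
  obtain ⟨K, hK0, hK⟩ := f.exists_riemannSum_bound
  refine ⟨A * (α + β) + μ * K, by positivity, ?_⟩
  rintro N hN z ⟨hanti, hval, hbot, htop⟩
  have hN0 : 0 < N := by omega
  have hN' : (0 : ℝ) < N := by exact_mod_cast hN0
  obtain ⟨hs, hKN⟩ := hK N hN0
  have hz (k : ℤ) : |z k| ≤ 1 := by
    obtain ⟨l, hl, h⟩ := hval k
    rw [h, abs_of_nonneg (by positivity), div_le_one hN']
    exact_mod_cast hl
  have hd := hasSum_sub_succ hanti hbot htop
  have hd' : HasSum (fun k => z (k - 1) - z k) 1 := by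
    have := (Equiv.subRight (1 : ℤ)).hasSum_iff.2 hd
    simpa [Function.comp_def] using this
  have hd0 (k : ℤ) : 0 ≤ z k - z (k + 1) := sub_nonneg.2 (hanti (by omega))
  have hd0' (k : ℤ) : 0 ≤ z (k - 1) - z k := sub_nonneg.2 (hanti (by omega))
  have hinv : |(N : ℝ)⁻¹| = (N : ℝ)⁻¹ := abs_of_nonneg (by positivity)
  have h1 : |∑' k : ℤ,
      ((Rf N f (z + ((N : ℝ))⁻¹ • eZ k) - Rf N f z) * α * (z (k - 1) - z k) +
       (Rf N f (z - ((N : ℝ))⁻¹ • eZ k) - Rf N f z) * β * (z k - z (k + 1)))|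
      ≤ (N : ℝ)⁻¹ * (A * (N : ℝ)⁻¹) * α * 1 + (N : ℝ)⁻¹ * (A * (N : ℝ)⁻¹) * β * 1 := by
    rw [← Real.norm_eq_abs]
    refine tsum_of_norm_bounded ((hd'.mul_left _).add (hd.mul_left _)) fun k => ?_
    refine (norm_add_le _ _).trans ?_
    have e1 := abs_Rf_add_smul_eZ_sub_le hA hs hz (N : ℝ)⁻¹ k
    have e2 := abs_Rf_add_smul_eZ_sub_le hA hs hz (-(N : ℝ)⁻¹) k
    rw [neg_smul, ← sub_eq_add_neg, abs_neg, hinv] at e2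
    rw [hinv] at e1
    simp only [Real.norm_eq_abs, abs_mul, abs_of_pos hα, abs_of_pos hβ, abs_of_nonneg (hd0 k),
      abs_of_nonneg (hd0' k)]
    have := hd0 k
    have := hd0' k
    gcongr
  have h2 : |∑' l : ℤ, ∑' k : ℤ, if l < k then
        (Rf N f (z - ((N : ℝ))⁻¹ • eBlock l k) - Rf N f z) * (z k - z (k + 1)) * (z l - z (l + 1))
      else 0| ≤ K / N * 1 := by
    rw [← Real.norm_eq_abs]
    refine tsum_of_norm_bounded (hd.mul_left (K / N)) fun l => ?_
    have hl : HasSum (fun k => K / N * (z k - z (k + 1)) * (z l - z (l + 1)))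
        (K / N * (z l - z (l + 1))) := by
      simpa using (hd.mul_left (K / N)).mul_right (z l - z (l + 1))
    refine tsum_of_norm_bounded hl fun k => ?_
    have hk := hd0 k
    have hl0 := hd0 l
    split_ifs
    · rw [norm_mul, norm_mul, Real.norm_of_nonneg hk, Real.norm_of_nonneg hl0]
      gcongr
      exact abs_Rf_sub_smul_eBlock_sub_le hN0 hs hKN hz l k
    · rw [norm_zero]
      positivity
  unfold LN
  refine (abs_add_le _ _).trans ?_
  rw [abs_mul, abs_mul _ (∑' l : ℤ, _), abs_of_pos hN', abs_of_pos (by positivity : 0 < N * (μ / N))]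
  calc _ ≤ (N : ℝ) * ((N : ℝ)⁻¹ * (A * (N : ℝ)⁻¹) * α * 1 + (N : ℝ)⁻¹ * (A * (N : ℝ)⁻¹) * β * 1)
        + N * (μ / N) * (K / N * 1) := by gcongr
    _ = (A * (α + β) + μ * K) / N := by field_simp
end

section
/- Let α, β, μ > 0 with α ≠ β and set μ_N = μ/N. For every Schwartz function f ∈ S(ℝ) there exists a constant C = C(f, α, β, μ) > 0 such that for every integer N ≥ 2 and every z ∈ H_N one has |N (L_N R_f²(z) − 2 R_f(z) · L_N R_f(z))| ≤ C/N, where R_f² denotes the function z ↦ (R_f(z))². -/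
open scoped BigOperators
open Filter

/-- The lattice sums of a Schwartz function with mesh `1 / N` converge absolutely and grow at most
linearly in `N`. -/
theorem SchwartzMap.exists_tsum_abs_lattice_le (f : SchwartzMap ℝ ℝ) :
    ∃ C : ℝ, 0 < C ∧ ∀ N : ℕ, 0 < N →
      Summable (fun k : ℤ => |f ((k : ℝ) / N)|) ∧ ∑' k : ℤ, |f ((k : ℝ) / N)| ≤ C * N := by
  obtain ⟨K₀, hK₀, h₀⟩ := f.decay 0 0
  obtain ⟨K₂, hK₂, h₂⟩ := f.decay 2 0
  simp only [pow_zero, one_mul, norm_iteratedFDeriv_zero, Real.norm_eq_abs, sq_abs] at h₀ h₂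
  set K := K₀ + K₂ with hK
  have hKpos : 0 < K := by positivity
  have hdecay : ∀ x, |f x| * (1 + x ^ 2) ≤ K := fun x => by nlinarith [h₀ x, h₂ x]
  have hg : Summable (fun q : ℤ => 3 * K / (1 + (q : ℝ) ^ 2)) := by
    have h1 : Summable (fun q : ℤ => 3 * K * (1 / (q : ℝ) ^ 2)) :=
      (Real.summable_one_div_int_pow.mpr one_lt_two).mul_left _
    refine h1.of_norm_bounded_eventually ?_
    have h0 : ∀ᶠ q : ℤ in cofinite, q ≠ 0 := by
      simpa using (Set.finite_singleton (0 : ℤ)).compl_mem_cofinite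
    filter_upwards [h0] with q hq
    have hq' : (0 : ℝ) < (q : ℝ) ^ 2 := by positivity
    rw [Real.norm_of_nonneg (by positivity), mul_one_div]
    gcongr
    linarith
  refine ⟨∑' q : ℤ, 3 * K / (1 + (q : ℝ) ^ 2), ?_, fun N hN => ?_⟩
  · exact hg.tsum_pos (fun q => by positivity) 0 (by positivity)
  have : NeZero N := ⟨hN.ne'⟩
  have hN' : (0 : ℝ) < N := by exact_mod_cast hN
  have hpw : ∀ p : ℤ × Fin N,
      |f ((((Int.divModEquiv N).symm p : ℤ) : ℝ) / N)| ≤ 3 * K / (1 + (p.1 : ℝ) ^ 2) := by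
    rintro ⟨q, r⟩
    have hr0 : (0 : ℝ) ≤ ((r : ℕ) : ℝ) / N := by positivity
    have hr1 : ((r : ℕ) : ℝ) / N ≤ 1 := by
      rw [div_le_one hN']; exact_mod_cast r.2.le
    have hx : (((Int.divModEquiv N).symm (q, r) : ℤ) : ℝ) / N = q + ((r : ℕ) : ℝ) / N := by
      simp only [Int.divModEquiv, Equiv.coe_fn_symm_mk]
      push_cast
      field_simp
    rw [hx, le_div_iff₀ (by positivity)]
    set y := ((r : ℕ) : ℝ) / N
    have h3 : (1 + (q : ℝ) ^ 2) ≤ 3 * (1 + (q + y) ^ 2) := by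
      nlinarith [sq_nonneg ((q : ℝ) + 2 * y), sq_nonneg ((q : ℝ) + y)]
    calc |f (q + y)| * (1 + (q : ℝ) ^ 2) ≤ |f (q + y)| * (3 * (1 + (q + y) ^ 2)) := by gcongr
      _ ≤ 3 * K := by linarith [hdecay (q + y)]
  have hprod : Summable (fun p : ℤ × Fin N => 3 * K / (1 + (p.1 : ℝ) ^ 2)) := by
    simpa using hg.mul_of_nonneg (g := fun _ : Fin N => (1 : ℝ)) Summable.of_finite
      (fun q => by positivity) (fun _ => by simp)
  have hsum := hprod.of_nonneg_of_le (fun p => abs_nonneg _) hpw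
  refine ⟨(Int.divModEquiv N).symm.summable_iff.mp hsum, ?_⟩
  rw [← (Int.divModEquiv N).symm.tsum_eq (fun k : ℤ => |f ((k : ℝ) / N)|)]
  refine (hsum.tsum_le_tsum hpw hprod).trans (le_of_eq ?_)
  rw [hprod.tsum_prod]
  simp [tsum_mul_left, mul_comm]

theorem HN.mem_Icc {N : ℕ} {z : ℤ → ℝ} (hz : z ∈ HN N) (k : ℤ) : z k ∈ Set.Icc (0 : ℝ) 1 := by
  obtain ⟨l, hl, h⟩ := hz.2.1 k
  rw [h]
  exact ⟨by positivity, div_le_one_of_le₀ (by exact_mod_cast hl) (by positivity)⟩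

/-- A configuration in `H_N` is eventually constant on both sides. -/
theorem HN.exists_eq_one_eq_zero {N : ℕ} (hN : 0 < N) {z : ℤ → ℝ} (hz : z ∈ HN N) :
    ∃ a b : ℤ, (∀ k ≤ a, z k = 1) ∧ ∀ k ≥ b, z k = 0 := by
  obtain ⟨-, hval, hbot, htop⟩ := hz
  have hN' : (0 : ℝ) < N := by exact_mod_cast hN
  have h1 : (1 : ℝ) - 1 / N < 1 := sub_lt_self 1 (by positivity)
  obtain ⟨a, ha⟩ := eventually_atBot.mp (hbot.eventually (lt_mem_nhds h1))
  obtain ⟨b, hb⟩ := eventually_atTop.mp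
    (htop.eventually (gt_mem_nhds (show (0 : ℝ) < 1 / N by positivity)))
  refine ⟨a, b, fun k hk => ?_, fun k hk => ?_⟩
  · obtain ⟨l, hl, h⟩ := hval k
    have h2 := ha k hk
    rw [h, lt_div_iff₀ hN', sub_mul, one_div_mul_cancel hN'.ne', one_mul] at h2
    have h3 : (N : ℝ) < l + 1 := by linarith
    have h4 : N < l + 1 := by exact_mod_cast h3
    rw [h, show l = N by omega, div_self hN'.ne']
  · obtain ⟨l, hl, h⟩ := hval k
    have h2 := hb k hk
    rw [h, div_lt_div_iff_of_pos_right hN'] at h2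
    have h4 : l < 1 := by exact_mod_cast h2
    rw [h, show l = 0 by omega]
    simp

theorem Int.sum_Ico_sub_le_one {z : ℤ → ℝ} (hz : ∀ k, z k ∈ Set.Icc (0 : ℝ) 1) (a b : ℤ) :
    ∑ k ∈ Finset.Ico a b, (z k - z (k + 1)) ≤ 1 := by
  rcases le_total b a with h | h
  · simp [Finset.Ico_eq_empty_of_le h]
  · have key : ∑ k ∈ Finset.Ico a b, (z k - z (k + 1)) = z a - z b := by
      induction b, h using Int.leInduction with
      | base => simp
      | succ b h ih =>
        rw [← Finset.insert_Ico_right_eq_Ico_add_one h, Finset.sum_insert (by simp), ih]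
        ring
    rw [key]
    linarith [(hz a).2, (hz b).1]

/-- `L_N` as a finite sum at a configuration whose increments vanish outside a finite set. -/
theorem LN_eq_finset_sum (N : ℕ) (α β ν : ℝ) (F : (ℤ → ℝ) → ℝ) (z : ℤ → ℝ) (s : Finset ℤ)
    (hs : ∀ k ∉ s, z k - z (k + 1) = 0) (hs' : ∀ k ∉ s, z (k - 1) - z k = 0) :
    LN N α β ν F z = (N : ℝ) * ∑ k ∈ s,
      ((F (z + ((N : ℝ))⁻¹ • eZ k) - F z) * α * (z (k - 1) - z k) +
       (F (z - ((N : ℝ))⁻¹ • eZ k) - F z) * β * (z k - z (k + 1))) +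
      (N : ℝ) * ν * ∑ l ∈ s, ∑ k ∈ s,
        if l < k then
          (F (z - ((N : ℝ))⁻¹ • eBlock l k) - F z) * (z k - z (k + 1)) * (z l - z (l + 1))
        else 0 := by
  unfold LN
  congr 2
  · exact tsum_eq_sum fun k hk => by rw [hs k hk, hs' k hk]; ring
  · rw [tsum_eq_sum (s := s) fun l hl => by simp [hs l hl]]
    exact Finset.sum_congr rfl fun l _ => tsum_eq_sum fun k hk => by simp [hs k hk]

/-- The carré du champ of `L_N` as a finite sum of squared increments. -/
theorem LN_sq_sub_two_mul (N : ℕ) (α β ν : ℝ) (F : (ℤ → ℝ) → ℝ) (z : ℤ → ℝ) (s : Finset ℤ)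
    (hs : ∀ k ∉ s, z k - z (k + 1) = 0) (hs' : ∀ k ∉ s, z (k - 1) - z k = 0) :
    LN N α β ν (fun w => F w ^ 2) z - 2 * F z * LN N α β ν F z = (N : ℝ) * ∑ k ∈ s,
      ((F (z + ((N : ℝ))⁻¹ • eZ k) - F z) ^ 2 * α * (z (k - 1) - z k) +
       (F (z - ((N : ℝ))⁻¹ • eZ k) - F z) ^ 2 * β * (z k - z (k + 1))) +
      (N : ℝ) * ν * ∑ l ∈ s, ∑ k ∈ s,
        if l < k then
          (F (z - ((N : ℝ))⁻¹ • eBlock l k) - F z) ^ 2 * (z k - z (k + 1)) * (z l - z (l + 1))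
        else 0 := by
  rw [LN_eq_finset_sum N α β ν _ z s hs hs', LN_eq_finset_sum N α β ν _ z s hs hs', mul_add,
    add_sub_add_comm, mul_left_comm (2 * F z) (N : ℝ), mul_left_comm (2 * F z) (N * ν : ℝ),
    ← mul_sub, ← mul_sub]
  simp only [Finset.mul_sum (a := 2 * F z), ← Finset.sum_sub_distrib]
  congr 2
  · exact Finset.sum_congr rfl fun k _ => by ring
  · refine Finset.sum_congr rfl fun l _ => ?_
    refine Finset.sum_congr rfl fun k _ => ?_
    split_ifs <;> ring

/-- Increment of `R_f` at a bounded configuration along a bounded direction. -/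
theorem Rf_add_smul_sub (N : ℕ) (f : SchwartzMap ℝ ℝ)
    (hf : Summable (fun k : ℤ => |f ((k : ℝ) / N)|)) (z e : ℤ → ℝ)
    (hz : ∀ k, |z k| ≤ 1) (he : ∀ k, |e k| ≤ 1) (c : ℝ) :
    Rf N f (z + c • e) - Rf N f z = c / N * ∑' k : ℤ, f ((k : ℝ) / N) * e k := by
  have hsum : ∀ w : ℤ → ℝ, (∀ k, |w k| ≤ 1) → Summable (fun k : ℤ => f ((k : ℝ) / N) * w k) :=
    fun w hw => hf.of_norm_bounded fun k => by
      rw [Real.norm_eq_abs, abs_mul]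
      exact mul_le_of_le_one_right (abs_nonneg _) (hw k)
  have h : ∑' k : ℤ, f ((k : ℝ) / N) * (z + c • e) k
      = ∑' k : ℤ, f ((k : ℝ) / N) * z k + c * ∑' k : ℤ, f ((k : ℝ) / N) * e k := by
    rw [← tsum_mul_left, ← (hsum z hz).tsum_add ((hsum e he).mul_left c)]
    refine tsum_congr fun k => ?_
    simp only [Pi.add_apply, Pi.smul_apply, smul_eq_mul]
    ring
  unfold Rf
  rw [h]
  ring

/-- for `α ≠ β`, `μ_N = μ/N`, the quadratic-variation-type bound
`|N (L_N R_f²(z) − 2 R_f(z) L_N R_f(z))| ≤ C/N` holds uniformly in `N ≥ 2` and `z ∈ H_N`. -/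
theorem statement1 (α β μ : ℝ) (hα : 0 < α) (hβ : 0 < β) (hμ : 0 < μ) (hαβ : α ≠ β)
    (f : SchwartzMap ℝ ℝ) :
    ∃ C : ℝ, 0 < C ∧ ∀ N : ℕ, 2 ≤ N → ∀ z ∈ HN N,
      |(N : ℝ) * (LN N α β (μ / N) (fun w => (Rf N f w) ^ 2) z
          - 2 * Rf N f z * LN N α β (μ / N) (Rf N f) z)| ≤ C / N := by
  obtain ⟨S, hS, hlat⟩ := f.exists_tsum_abs_lattice_le
  obtain ⟨M, hM, hfM⟩ := f.decay 0 0
  simp only [pow_zero, one_mul, norm_iteratedFDeriv_zero, Real.norm_eq_abs] at hfM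
  refine ⟨M ^ 2 * (α + β) + μ * S ^ 2, by positivity, fun N hN z hz => ?_⟩
  have hN1 : (1 : ℝ) ≤ N := by exact_mod_cast (by omega : 1 ≤ N)
  have hN0 : (0 : ℝ) < N := by linarith
  obtain ⟨hf, hfS⟩ := hlat N (by omega)
  obtain ⟨a, b, ha, hb⟩ := HN.exists_eq_one_eq_zero (by omega) hz
  have hmem := HN.mem_Icc hz
  have hanti : Antitone z := hz.1
  have hz1 : ∀ k, |z k| ≤ 1 := fun k => abs_le.mpr ⟨by linarith [(hmem k).1], (hmem k).2⟩
  have hZ1 : ∀ j k, |eZ j k| ≤ 1 := fun j k => by unfold eZ; split_ifs <;> simp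
  have hB1 : ∀ l j k, |eBlock l j k| ≤ 1 := fun l j k => by unfold eBlock; split_ifs <;> simp
  set s := Finset.Ico a (b + 1)
  have hs : ∀ k ∉ s, z k - z (k + 1) = 0 := fun k hk => by
    rw [Finset.mem_Ico, not_and_or, not_le, not_lt] at hk
    rcases hk with hk | hk
    · rw [ha k hk.le, ha (k + 1) (by omega), sub_self]
    · rw [hb k (by omega), hb (k + 1) (by omega), sub_self]
  have hs' : ∀ k ∉ s, z (k - 1) - z k = 0 := fun k hk => by
    rw [Finset.mem_Ico, not_and_or, not_le, not_lt] at hk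
    rcases hk with hk | hk
    · rw [ha k hk.le, ha (k - 1) (by omega), sub_self]
    · rw [hb k (by omega), hb (k - 1) (by omega), sub_self]
  have hd : ∀ k, 0 ≤ z k - z (k + 1) := fun k => sub_nonneg.mpr (hanti (by omega))
  have hd' : ∀ k, 0 ≤ z (k - 1) - z k := fun k => sub_nonneg.mpr (hanti (by omega))
  have hsum : ∑ k ∈ s, (z k - z (k + 1)) ≤ 1 := Int.sum_Ico_sub_le_one hmem a (b + 1)
  have hsum' : ∑ k ∈ s, (z (k - 1) - z k) ≤ 1 := by
    simpa using Int.sum_Ico_sub_le_one (z := fun k => z (k - 1)) (fun k => hmem _) a (b + 1)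
  have htZ : ∀ j : ℤ, ∑' k : ℤ, f ((k : ℝ) / N) * eZ j k = f ((j : ℝ) / N) := fun j => by
    rw [tsum_eq_single j fun k hk => by simp [eZ, hk]]
    simp [eZ]
  have htB : ∀ l j : ℤ, |∑' k : ℤ, f ((k : ℝ) / N) * eBlock l j k| ≤ S * N := fun l j =>
    (tsum_of_norm_bounded hf.hasSum fun k => by
      rw [Real.norm_eq_abs, abs_mul]
      exact mul_le_of_le_one_right (abs_nonneg _) (hB1 l j k)).trans hfS
  have hsub : ∀ e : ℤ → ℝ, z - (N : ℝ)⁻¹ • e = z + (-(N : ℝ)⁻¹) • e := fun e => by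
    rw [neg_smul, sub_eq_add_neg]
  have hplus : ∀ k, (Rf N f (z + (N : ℝ)⁻¹ • eZ k) - Rf N f z) ^ 2 ≤ M ^ 2 / N ^ 4 := fun k => by
    rw [Rf_add_smul_sub N f hf z _ hz1 (hZ1 k), htZ]
    have h1 := sq_le_sq' (neg_le_of_abs_le (hfM (k / N))) (le_of_abs_le (hfM (k / N)))
    calc ((N : ℝ)⁻¹ / N * f (k / N)) ^ 2 = f (k / N) ^ 2 / N ^ 4 := by field_simp
      _ ≤ M ^ 2 / N ^ 4 := by gcongr
  have hminus : ∀ k, (Rf N f (z - (N : ℝ)⁻¹ • eZ k) - Rf N f z) ^ 2 ≤ M ^ 2 / N ^ 4 := fun k => by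
    rw [hsub, Rf_add_smul_sub N f hf z _ hz1 (hZ1 k), htZ]
    have h1 := sq_le_sq' (neg_le_of_abs_le (hfM (k / N))) (le_of_abs_le (hfM (k / N)))
    calc (-(N : ℝ)⁻¹ / N * f (k / N)) ^ 2 = f (k / N) ^ 2 / N ^ 4 := by field_simp
      _ ≤ M ^ 2 / N ^ 4 := by gcongr
  have hblock : ∀ l k, (Rf N f (z - (N : ℝ)⁻¹ • eBlock l k) - Rf N f z) ^ 2 ≤ S ^ 2 / N ^ 2 :=
    fun l k => by
      rw [hsub, Rf_add_smul_sub N f hf z _ hz1 (hB1 l k)]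
      set T := ∑' m : ℤ, f ((m : ℝ) / N) * eBlock l k m
      have h1 := sq_le_sq' (neg_le_of_abs_le (htB l k)) (le_of_abs_le (htB l k))
      calc (-(N : ℝ)⁻¹ / N * T) ^ 2 = T ^ 2 / N ^ 4 := by field_simp
        _ ≤ (S * N) ^ 2 / N ^ 4 := by gcongr
        _ = S ^ 2 / N ^ 2 := by field_simp
  rw [LN_sq_sub_two_mul N α β (μ / N) (Rf N f) z s hs hs']
  have hX0 : 0 ≤ ∑ k ∈ s,
      ((Rf N f (z + (N : ℝ)⁻¹ • eZ k) - Rf N f z) ^ 2 * α * (z (k - 1) - z k) +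
       (Rf N f (z - (N : ℝ)⁻¹ • eZ k) - Rf N f z) ^ 2 * β * (z k - z (k + 1))) :=
    Finset.sum_nonneg fun k _ => by have := hd k; have := hd' k; positivity
  have hX : ∑ k ∈ s,
      ((Rf N f (z + (N : ℝ)⁻¹ • eZ k) - Rf N f z) ^ 2 * α * (z (k - 1) - z k) +
       (Rf N f (z - (N : ℝ)⁻¹ • eZ k) - Rf N f z) ^ 2 * β * (z k - z (k + 1)))
      ≤ M ^ 2 / N ^ 4 * (α + β) := by
    calc _ ≤ ∑ k ∈ s, (M ^ 2 / N ^ 4 * α * (z (k - 1) - z k) +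
          M ^ 2 / N ^ 4 * β * (z k - z (k + 1))) := Finset.sum_le_sum fun k _ => by
            have := hd k; have := hd' k; have := hplus k; have := hminus k
            gcongr
      _ = M ^ 2 / N ^ 4 * α * ∑ k ∈ s, (z (k - 1) - z k) +
          M ^ 2 / N ^ 4 * β * ∑ k ∈ s, (z k - z (k + 1)) := by
            rw [Finset.sum_add_distrib, Finset.mul_sum, Finset.mul_sum]
      _ ≤ M ^ 2 / N ^ 4 * α * 1 + M ^ 2 / N ^ 4 * β * 1 := by gcongr
      _ = _ := by ring
  have hY0 : 0 ≤ ∑ l ∈ s, ∑ k ∈ s, if l < k then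
      (Rf N f (z - (N : ℝ)⁻¹ • eBlock l k) - Rf N f z) ^ 2 * (z k - z (k + 1)) *
        (z l - z (l + 1)) else 0 :=
    Finset.sum_nonneg fun l _ => Finset.sum_nonneg fun k _ => by
      have := hd k; have := hd l; split_ifs <;> positivity
  have hY : (∑ l ∈ s, ∑ k ∈ s, if l < k then
      (Rf N f (z - (N : ℝ)⁻¹ • eBlock l k) - Rf N f z) ^ 2 * (z k - z (k + 1)) *
        (z l - z (l + 1)) else 0) ≤ S ^ 2 / N ^ 2 := by
    calc _ ≤ ∑ l ∈ s, ∑ k ∈ s, S ^ 2 / N ^ 2 * (z k - z (k + 1)) * (z l - z (l + 1)) :=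
          Finset.sum_le_sum fun l _ => Finset.sum_le_sum fun k _ => by
            have := hd k; have := hd l; have := hblock l k
            split_ifs
            · gcongr
            · positivity
      _ = S ^ 2 / N ^ 2 * ((∑ k ∈ s, (z k - z (k + 1))) * ∑ l ∈ s, (z l - z (l + 1))) := by
            simp only [← Finset.sum_mul, ← Finset.mul_sum, mul_assoc]
      _ ≤ S ^ 2 / N ^ 2 * (1 * 1) := by
            have := Finset.sum_nonneg fun k (_ : k ∈ s) => hd k
            gcongr
      _ = _ := by ring
  rw [abs_of_nonneg (by positivity)]
  calc _ ≤ (N : ℝ) * (N * (M ^ 2 / N ^ 4 * (α + β)) + N * (μ / N) * (S ^ 2 / N ^ 2)) := by gcongr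
    _ = M ^ 2 * (α + β) / N ^ 2 + μ * S ^ 2 / N := by field_simp
    _ ≤ M ^ 2 * (α + β) / N + μ * S ^ 2 / N := by
      gcongr
      exact le_self_pow₀ hN1 two_ne_zero
    _ = _ := by ring
end

section
/- Let κ : ℝ → ℝ be a nonnegative, infinitely differentiable, compactly supported function with ∫_ℝ κ(y) dy = 1, and for ε ∈ (0,1] set κ_ε(y) = κ(y/ε)/ε. Let f : ℝ → ℝ be infinitely differentiable with compact support. Then there exist functions F₁, F₂ : (0,∞) → [0,∞), depending only on f and κ, with F₁(ε) → 0 as ε ↓ 0 and F₂(r) → 0 as r → +∞, such that for every integer N ≥ 2, every ε ∈ (0,1] and every z ∈ H_N one has |(1/N) Σ_{k∈ℤ} f(k/N) z_k² − ∫_ℝ ((κ_ε * ζ_z)(x))² f(x) dx| ≤ F₁(ε) + F₂(εN). -/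
open MeasureTheory Filter

/-- The rescaled mollifier `κ_ε(y) = κ(y/ε)/ε`. -/
noncomputable def kEps (κ : ℝ → ℝ) (ε : ℝ) (y : ℝ) : ℝ := κ (y / ε) / ε

/-- The step function `ζ_z(x) = z_{⌊Nx⌋}` associated with a configuration `z ∈ H_N`. -/
noncomputable def zetaStep (N : ℕ) (z : ℤ → ℝ) (x : ℝ) : ℝ := z ⌊(N : ℝ) * x⌋

theorem integral_comp_floor_mul (N : ℕ) (hN : 0 < N) (g : ℤ → ℝ) (hg : g.support.Finite) :
    (∫ x : ℝ, g ⌊(N : ℝ) * x⌋) = (1 / (N : ℝ)) * ∑' k, g k := by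
  have hm : Measurable (Int.floor : ℝ → ℤ) := Int.measurable_floor
  have hmap : ∀ k : ℤ, (Measure.map (Int.floor : ℝ → ℤ) volume) {k} = 1 := by
    intro k
    rw [Measure.map_apply hm (measurableSet_singleton k), Int.preimage_floor_singleton,
      Real.volume_Ico]
    simp
  have hint : Integrable g (Measure.map (Int.floor : ℝ → ℤ) volume) := by
    rw [← integrableOn_iff_integrable_of_support_subset subset_rfl,
      ← Set.biUnion_of_singleton g.support, integrableOn_finite_biUnion hg]
    exact fun k _ => integrableOn_singleton (hx := by simp [hmap k])
  have hone : (∫ x : ℝ, g ⌊x⌋) = ∑' k, g k := by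
    rw [← integral_map (f := g) hm.aemeasurable hint.aestronglyMeasurable,
      integral_countable hint]
    simp [Measure.real, hmap]
  rw [Measure.integral_comp_mul_left (fun x : ℝ => g ⌊x⌋) (N : ℝ), hone, abs_of_nonneg (by positivity)]
  simp

theorem abs_sum_sub_integral_le {f : ℝ → ℝ} {L R : ℝ}
    (hfc : Continuous f) (hL : ∀ x y, |f x - f y| ≤ L * |x - y|)
    (hR : 0 ≤ R) (hf : ∀ x, R < |x| → f x = 0)
    {N : ℕ} (hN : 0 < N) {z : ℤ → ℝ} (hz0 : ∀ k, 0 ≤ z k) (hz1 : ∀ k, z k ≤ 1) :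
    |(1 / (N : ℝ)) * ∑' k : ℤ, f ((k : ℝ) / N) * (z k) ^ 2
        - ∫ x : ℝ, (zetaStep N z x) ^ 2 * f x| ≤ 2 * (R + 1) * L / N := by
  have hN' : (0 : ℝ) < N := by exact_mod_cast hN
  have hL0 : 0 ≤ L := by
    have := (abs_nonneg _).trans (hL 1 0)
    simpa using this
  have hsupp : (fun k : ℤ => f ((k : ℝ) / N) * (z k) ^ 2).support.Finite := by
    refine (Set.finite_Icc (-⌈R * N⌉) ⌈R * N⌉).subset fun k hk => ?_
    have h1 : |(k : ℝ) / N| ≤ R := by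
      by_contra! h
      exact hk (by simp [hf _ h])
    rw [abs_div, abs_of_pos hN', div_le_iff₀ hN', abs_le] at h1
    have h2 := Int.le_ceil (R * N)
    constructor
    · have : (-⌈R * N⌉ : ℝ) ≤ k := by linarith
      exact_mod_cast this
    · have : (k : ℝ) ≤ ⌈R * N⌉ := by linarith
      exact_mod_cast this
  rw [← integral_comp_floor_mul N hN _ hsupp]
  have hfl : Measurable fun x : ℝ => ⌊(N : ℝ) * x⌋ :=
    Int.measurable_floor.comp (measurable_const_mul _)
  have hcell : ∀ x : ℝ, |(⌊(N : ℝ) * x⌋ : ℝ) / N - x| ≤ 1 / N := by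
    intro x
    have h1 := Int.floor_le ((N : ℝ) * x)
    have h2 := Int.lt_floor_add_one ((N : ℝ) * x)
    have : (⌊(N : ℝ) * x⌋ : ℝ) / N - x = (⌊(N : ℝ) * x⌋ - N * x) / N := by field_simp
    rw [this, abs_div, abs_of_pos hN']
    gcongr
    rw [abs_le]; constructor <;> linarith
  have hNi : 1 / (N : ℝ) ≤ 1 := by
    rw [div_le_one hN']; exact_mod_cast hN
  have hsq : ∀ k, |z k ^ 2| ≤ 1 := fun k => by
    rw [abs_of_nonneg (sq_nonneg _)]
    exact pow_le_one₀ (hz0 k) (hz1 k)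
  have hzm : Measurable fun x : ℝ => z ⌊(N : ℝ) * x⌋ := (measurable_from_top (f := z)).comp hfl
  have hi2 : Integrable fun x : ℝ => (zetaStep N z x) ^ 2 * f x := by
    refine (hfc.integrable_of_hasCompactSupport (HasCompactSupport.intro
      (isCompact_Icc (a := -R) (b := R)) fun x hx => hf x ?_)).bdd_mul (c := 1)
      (hzm.pow_const 2).aestronglyMeasurable (ae_of_all _ fun x => hsq _)
    by_contra! h
    exact hx (abs_le.1 h)
  have hbound : ∀ x : ℝ, ‖f ((⌊(N : ℝ) * x⌋ : ℝ) / N) * (z ⌊(N : ℝ) * x⌋) ^ 2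
      - (zetaStep N z x) ^ 2 * f x‖
      ≤ (Set.Icc (-(R + 1)) (R + 1)).indicator (fun _ => L / N) x := by
    intro x
    have : f ((⌊(N : ℝ) * x⌋ : ℝ) / N) * (z ⌊(N : ℝ) * x⌋) ^ 2 - (zetaStep N z x) ^ 2 * f x
      = (z ⌊(N : ℝ) * x⌋) ^ 2 * (f ((⌊(N : ℝ) * x⌋ : ℝ) / N) - f x) := by
      simp only [zetaStep]; ring
    rw [this, Real.norm_eq_abs, abs_mul]
    by_cases hx : x ∈ Set.Icc (-(R + 1)) (R + 1)
    · rw [Set.indicator_of_mem hx]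
      calc _ ≤ 1 * (L * (1 / N)) := by
            gcongr
            · exact hsq _
            · exact (hL _ _).trans (by gcongr; exact hcell x)
        _ = L / N := by ring
    · rw [Set.indicator_of_notMem hx]
      have hx' : R + 1 < |x| := by
        by_contra! h
        exact hx (abs_le.1 h)
      have h3 : |x| - |(⌊(N : ℝ) * x⌋ : ℝ) / N| ≤ |x - (⌊(N : ℝ) * x⌋ : ℝ) / N| :=
        abs_sub_abs_le_abs_sub _ _
      rw [abs_sub_comm] at h3
      have h4 := hcell x
      rw [hf x (by linarith), hf _ (by linarith : R < |(⌊(N : ℝ) * x⌋ : ℝ) / N|)]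
      simp
  have hgi : Integrable ((Set.Icc (-(R + 1)) (R + 1)).indicator (fun _ : ℝ => L / (N : ℝ))) :=
    (integrable_indicator_iff measurableSet_Icc).2 (integrableOn_const (by simp))
  have hm1 : Measurable fun x : ℝ => f ((⌊(N : ℝ) * x⌋ : ℝ) / N) * (z ⌊(N : ℝ) * x⌋) ^ 2 :=
    (measurable_from_top (f := fun k : ℤ => f ((k : ℝ) / N) * (z k) ^ 2)).comp hfl
  have hi3 := hgi.mono' (hm1.aestronglyMeasurable.sub hi2.aestronglyMeasurable)
    (ae_of_all _ hbound)
  have hi1 : Integrable fun x : ℝ => f ((⌊(N : ℝ) * x⌋ : ℝ) / N) * (z ⌊(N : ℝ) * x⌋) ^ 2 := by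
    refine (hi3.add hi2).congr (ae_of_all _ fun x => ?_)
    simp
  rw [← integral_sub hi1 hi2]
  refine (norm_integral_le_of_norm_le hgi (ae_of_all _ hbound)).trans_eq ?_
  rw [integral_indicator measurableSet_Icc, setIntegral_const, Measure.real, Real.volume_Icc,
    ENNReal.toReal_ofReal (by linarith), smul_eq_mul]
  ring

theorem integral_mul_mem_Icc_of_antitone {κ g : ℝ → ℝ} {δ : ℝ} (hκ : Integrable κ)
    (hκ0 : ∀ y, 0 ≤ κ y) (hκ1 : ∫ y, κ y = 1) (hsupp : ∀ y, δ < |y| → κ y = 0)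
    (hg : Antitone g) {C : ℝ} (hb : ∀ x, |g x| ≤ C) (x : ℝ) :
    (∫ y, κ (x - y) * g y) ∈ Set.Icc (g (x + δ)) (g (x - δ)) := by
  have hκx : Integrable fun y => κ (x - y) := hκ.comp_sub_left x
  have hone : ∫ y, κ (x - y) = 1 := by rw [integral_sub_left_eq_self κ volume x, hκ1]
  have hint : Integrable fun y => κ (x - y) * g y :=
    hκx.mul_bdd (c := C) hg.measurable.aestronglyMeasurable (ae_of_all _ hb)
  have hnear : ∀ y, κ (x - y) ≠ 0 → |x - y| ≤ δ := fun y hy => by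
    by_contra! h
    exact hy (hsupp _ h)
  constructor
  · calc g (x + δ) = ∫ y, κ (x - y) * g (x + δ) := by rw [integral_mul_const, hone, one_mul]
      _ ≤ _ := by
        refine integral_mono (hκx.mul_const _) hint fun y => ?_
        by_cases h : κ (x - y) = 0
        · simp [h]
        · have := abs_le.1 (hnear y h)
          exact mul_le_mul_of_nonneg_left (hg (by linarith)) (hκ0 _)
  · calc _ ≤ ∫ y, κ (x - y) * g (x - δ) := by
          refine integral_mono hint (hκx.mul_const _) fun y => ?_
          by_cases h : κ (x - y) = 0
          · simp [h]
          · have := abs_le.1 (hnear y h)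
            exact mul_le_mul_of_nonneg_left (hg (by linarith)) (hκ0 _)
      _ = _ := by rw [integral_mul_const, hone, one_mul]

theorem intervalIntegral_shift_sub_shift_le {g : ℝ → ℝ} (hg : Antitone g)
    (hg0 : ∀ x, 0 ≤ g x) (hg1 : ∀ x, g x ≤ 1) {δ : ℝ} (hδ : 0 ≤ δ) (a b : ℝ) :
    (∫ x in a..b, (g (x - δ) - g (x + δ))) ≤ 2 * δ := by
  have hi : ∀ u v : ℝ, IntervalIntegrable g volume u v := fun u v => hg.intervalIntegrable
  have h1 : IntervalIntegrable (fun x => g (x - δ)) volume a b :=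
    Antitone.intervalIntegrable fun x y h => hg (by linarith)
  have h2 : IntervalIntegrable (fun x => g (x + δ)) volume a b :=
    Antitone.intervalIntegrable fun x y h => hg (by linarith)
  rw [intervalIntegral.integral_sub h1 h2, intervalIntegral.integral_comp_sub_right,
    intervalIntegral.integral_comp_add_right]
  have e1 := intervalIntegral.integral_add_adjacent_intervals (hi (a - δ) (a + δ))
    (hi (a + δ) (b + δ))
  have e2 := intervalIntegral.integral_add_adjacent_intervals (hi (a - δ) (b - δ))
    (hi (b - δ) (b + δ))
  have u1 : (∫ x in (a - δ)..(a + δ), g x) ≤ ∫ x in (a - δ)..(a + δ), (1 : ℝ) :=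
    intervalIntegral.integral_mono_on (by linarith) (hi _ _) intervalIntegrable_const
      fun x _ => hg1 x
  have u2 : 0 ≤ ∫ x in (b - δ)..(b + δ), g x :=
    intervalIntegral.integral_nonneg (by linarith) fun x _ => hg0 x
  rw [intervalIntegral.integral_const, smul_eq_mul] at u1
  linarith

theorem abs_integral_sq_sub_integral_mollified_sq_le {κ f g : ℝ → ℝ} {δ M R : ℝ}
    (hκ : Integrable κ) (hκc : Continuous κ)
    (hκ0 : ∀ y, 0 ≤ κ y) (hκ1 : ∫ y, κ y = 1) (hδ : 0 ≤ δ) (hsupp : ∀ y, δ < |y| → κ y = 0)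
    (hg : Antitone g) (hg0 : ∀ x, 0 ≤ g x) (hg1 : ∀ x, g x ≤ 1)
    (hfc : Continuous f) (hM : ∀ x, |f x| ≤ M) (hR : 0 ≤ R) (hf : ∀ x, R < |x| → f x = 0) :
    |(∫ x, (g x) ^ 2 * f x) - ∫ x, (∫ y, κ (x - y) * g y) ^ 2 * f x| ≤ 4 * M * δ := by
  have hM0 : 0 ≤ M := (abs_nonneg _).trans (hM 0)
  have hgm := hg.measurable
  set c : ℝ → ℝ := fun x => ∫ y, κ (x - y) * g y
  have hcm : StronglyMeasurable c := by
    refine StronglyMeasurable.integral_prod_right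
      (f := fun x y => κ (x - y) * g y) (Measurable.stronglyMeasurable ?_)
    exact (hκc.measurable.comp (measurable_fst.sub measurable_snd)).mul (hgm.comp measurable_snd)
  have hmem : ∀ x, c x ∈ Set.Icc (g (x + δ)) (g (x - δ)) :=
    integral_mul_mem_Icc_of_antitone hκ hκ0 hκ1 hsupp hg (C := 1)
      fun x => abs_le.2 ⟨by linarith [hg0 x], hg1 x⟩
  have hc0 : ∀ x, 0 ≤ c x := fun x => (hg0 _).trans (hmem x).1
  have hc1 : ∀ x, c x ≤ 1 := fun x => (hmem x).2.trans (hg1 _)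
  have hfi : Integrable f := by
    refine hfc.integrable_of_hasCompactSupport (HasCompactSupport.intro
      (isCompact_Icc (a := -R) (b := R)) fun x hx => hf x ?_)
    by_contra! h
    exact hx (abs_le.1 h)
  have hi1 : Integrable fun x => (g x) ^ 2 * f x :=
    hfi.bdd_mul (c := 1) (hgm.pow_const 2).aestronglyMeasurable (ae_of_all _ fun x => by
      rw [Real.norm_of_nonneg (sq_nonneg _)]; exact pow_le_one₀ (hg0 x) (hg1 x))
  have hi2 : Integrable fun x => (c x) ^ 2 * f x :=
    hfi.bdd_mul (c := 1) (hcm.pow 2).aestronglyMeasurable (ae_of_all _ fun x => by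
      rw [Real.norm_of_nonneg (sq_nonneg _)]; exact pow_le_one₀ (hc0 x) (hc1 x))
  rw [← integral_sub hi1 hi2]
  have hbound : ∀ x, ‖(g x) ^ 2 * f x - (c x) ^ 2 * f x‖
      ≤ (Set.Ioc (-(R + 1)) (R + 1)).indicator
        (fun x => 2 * M * (g (x - δ) - g (x + δ))) x := by
    intro x
    by_cases hx : x ∈ Set.Ioc (-(R + 1)) (R + 1)
    · rw [Set.indicator_of_mem hx]
      have e : (g x) ^ 2 * f x - (c x) ^ 2 * f x = (g x + c x) * f x * (g x - c x) := by ring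
      have h1 : |g x + c x| ≤ 2 :=
        abs_le.2 ⟨by linarith [hg0 x, hc0 x], by linarith [hg1 x, hc1 x]⟩
      have h2 : |g x - c x| ≤ g (x - δ) - g (x + δ) := by
        have a1 : g x ≤ g (x - δ) := hg (by linarith)
        have a2 : g (x + δ) ≤ g x := hg (by linarith)
        exact abs_le.2 ⟨by linarith [(hmem x).2], by linarith [(hmem x).1]⟩
      rw [e, Real.norm_eq_abs, abs_mul, abs_mul]
      gcongr
      exact hM x
    · rw [Set.indicator_of_notMem hx, hf x]
      · simp
      · by_contra! h
        rw [abs_le] at h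
        exact hx ⟨by linarith, by linarith⟩
  have hab : -(R + 1) ≤ R + 1 := by linarith
  have hii : IntervalIntegrable (fun x => 2 * M * (g (x - δ) - g (x + δ))) volume
      (-(R + 1)) (R + 1) :=
    ((Antitone.intervalIntegrable fun x y h => hg (by linarith)).sub
      (Antitone.intervalIntegrable fun x y h => hg (by linarith))).const_mul _
  have hgi := (integrable_indicator_iff measurableSet_Ioc).2
    ((intervalIntegrable_iff_integrableOn_Ioc_of_le hab).1 hii)
  refine (norm_integral_le_of_norm_le hgi (ae_of_all _ hbound)).trans ?_
  rw [integral_indicator measurableSet_Ioc, ← intervalIntegral.integral_of_le hab,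
    intervalIntegral.integral_const_mul]
  calc _ ≤ 2 * M * (2 * δ) := by
        gcongr
        exact intervalIntegral_shift_sub_shift_le hg hg0 hg1 hδ _ _
    _ = _ := by ring

theorem HasCompactSupport.exists_eq_zero_of_lt_abs {f : ℝ → ℝ} (hf : HasCompactSupport f) :
    ∃ R, 0 ≤ R ∧ ∀ x, R < |x| → f x = 0 := by
  obtain ⟨R, hR⟩ := hf.isCompact.isBounded.subset_closedBall 0
  refine ⟨max R 0, le_max_right _ _, fun x hx => ?_⟩
  by_contra h
  have := hR (subset_tsupport f h)
  rw [mem_closedBall_zero_iff, Real.norm_eq_abs] at this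
  exact absurd (this.trans (le_max_left _ _)) (not_le.2 hx)

/-- uniform approximation of the nonlinear term by the smoothed empirical
profile: `|(1/N) Σ f(k/N) z_k² − ∫ (κ_ε * ζ_z)² f| ≤ F₁(ε) + F₂(εN)`. -/
theorem statement6 (κ : ℝ → ℝ) (hκ_smooth : ContDiff ℝ (⊤ : ℕ∞) κ)
    (hκ_supp : HasCompactSupport κ) (hκ_nonneg : ∀ y, 0 ≤ κ y)
    (hκ_int : ∫ y : ℝ, κ y = 1)
    (f : ℝ → ℝ) (hf_smooth : ContDiff ℝ (⊤ : ℕ∞) f) (hf_supp : HasCompactSupport f) :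
    ∃ F₁ F₂ : ℝ → ℝ, (∀ r, 0 ≤ F₁ r) ∧ (∀ r, 0 ≤ F₂ r) ∧
      Tendsto F₁ (nhdsWithin 0 (Set.Ioi 0)) (nhds 0) ∧
      Tendsto F₂ atTop (nhds 0) ∧
      ∀ N : ℕ, 2 ≤ N → ∀ ε ∈ Set.Ioc (0 : ℝ) 1, ∀ z ∈ HN N,
        |(1 / (N : ℝ)) * ∑' k : ℤ, f ((k : ℝ) / N) * (z k) ^ 2
            - ∫ x : ℝ, (∫ y : ℝ, kEps κ ε (x - y) * zetaStep N z y) ^ 2 * f x|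
          ≤ F₁ ε + F₂ (ε * N) := by
  obtain ⟨Rκ, hRκ, hκR⟩ := hκ_supp.exists_eq_zero_of_lt_abs
  obtain ⟨R, hR, hfR⟩ := hf_supp.exists_eq_zero_of_lt_abs
  obtain ⟨M, hM⟩ := hf_smooth.continuous.bounded_above_of_compact_support hf_supp
  obtain ⟨L, hL⟩ := hf_smooth.lipschitzWith_of_hasCompactSupport hf_supp (by simp)
  have hM0 : 0 ≤ M := (norm_nonneg _).trans (hM 0)
  refine ⟨fun ε => 4 * M * (Rκ * |ε|), fun r => 2 * (R + 1) * L / |r|,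
    fun r => by positivity, fun r => by positivity, ?_, ?_, ?_⟩
  · refine tendsto_nhdsWithin_of_tendsto_nhds ?_
    have : Continuous fun ε : ℝ => 4 * M * (Rκ * |ε|) := by fun_prop
    simpa using this.tendsto 0
  · exact tendsto_const_nhds.div_atTop tendsto_abs_atTop_atTop
  · rintro N hN ε ⟨hε0, hε1⟩ z ⟨hz, hzv, -, -⟩
    have hN0 : 0 < N := by omega
    have hN' : (0 : ℝ) < N := by exact_mod_cast hN0
    have hz0 : ∀ k, 0 ≤ z k := fun k => by
      obtain ⟨l, -, h⟩ := hzv k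
      rw [h]; positivity
    have hz1 : ∀ k, z k ≤ 1 := fun k => by
      obtain ⟨l, hl, h⟩ := hzv k
      rw [h, div_le_one hN']; exact_mod_cast hl
    have hζ : Antitone (zetaStep N z) := fun x y h =>
      hz (Int.floor_mono (mul_le_mul_of_nonneg_left h hN'.le))
    have hκc := hκ_smooth.continuous
    have hkint : Integrable (kEps κ ε) :=
      ((hκc.integrable_of_hasCompactSupport hκ_supp).comp_div hε0.ne').div_const ε
    have hk1 : ∫ y, kEps κ ε y = 1 := by
      simp only [kEps]
      rw [integral_div, Measure.integral_comp_div, hκ_int, abs_of_pos hε0, smul_eq_mul, mul_one,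
        div_self hε0.ne']
    have hsum := abs_sum_sub_integral_le hf_smooth.continuous
      (fun x y => by simpa [Real.dist_eq] using hL.dist_le_mul x y) hR hfR hN0 hz0 hz1
    have hmoll := abs_integral_sq_sub_integral_mollified_sq_le hkint
      (by unfold kEps; fun_prop) (fun y => div_nonneg (hκ_nonneg _) hε0.le) hk1
      (by positivity : 0 ≤ Rκ * ε)
      (fun y hy => by
        rw [kEps, hκR, zero_div]
        rwa [abs_div, abs_of_pos hε0, lt_div_iff₀ hε0])
      hζ (fun x => hz0 _) (fun x => hz1 _) hf_smooth.continuous hM hR hfR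
    have hεN : 2 * (R + 1) * L / N ≤ 2 * (R + 1) * L / (ε * N) := by
      gcongr
      exact mul_le_of_le_one_left hN'.le hε1
    beta_reduce
    rw [abs_of_pos hε0, abs_of_pos (mul_pos hε0 hN')]
    refine (abs_sub_le _ (∫ x : ℝ, (zetaStep N z x) ^ 2 * f x) _).trans ?_
    linarith
end

section
/- Let λ ∈ ℝ, μ > 0, T > 0 and let ψ : ℝ → ℝ be bounded and measurable. If u and v are two bounded measurable weak solutions on [0,T] × ℝ of the Cauchy problem u_t = −λ u_x + μ(u² − u), u(0,·) = ψ (in the sense of the weak formulation below), then u(t,x) = v(t,x) for almost every (t,x) ∈ [0,T] × ℝ. -/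
open MeasureTheory Filter intervalIntegral

/-- A test function on `[0,T] × ℝ`: infinitely differentiable, compactly supported,
and vanishing at time `T`. -/
def IsTestFn (T : ℝ) (f : ℝ → ℝ → ℝ) : Prop :=
  ContDiff ℝ (⊤ : ℕ∞) (Function.uncurry f) ∧ HasCompactSupport (Function.uncurry f) ∧
    ∀ x : ℝ, f T x = 0

/-- `u` is a bounded measurable weak solution on `[0,T] × ℝ` of
`u_t = −λ u_x + μ(u² − u)`, `u(0,·) = ψ`. -/
def IsWeakSolution (lam μ T : ℝ) (ψ : ℝ → ℝ) (u : ℝ → ℝ → ℝ) : Prop :=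
  (∃ M : ℝ, ∀ t x : ℝ, |u t x| ≤ M) ∧
  Measurable (Function.uncurry u) ∧
  ∀ f : ℝ → ℝ → ℝ, IsTestFn T f →
    (∫ t in (0 : ℝ)..T, ∫ x : ℝ,
        (u t x * (deriv (fun s => f s x) t + lam * deriv (fun y => f t y) x)
          + μ * u t x * (1 - u t x) * f t x))
      + (∫ x : ℝ, ψ x * f 0 x) = 0

/-- An interval-integrable function all of whose moments vanish on `[0,T]` is a.e. zero there. -/
theorem ae_eq_zero_of_moments_eq_zero {T : ℝ} (hT : 0 < T) {g : ℝ → ℝ}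
    (hg : IntervalIntegrable g volume 0 T)
    (hmom : ∀ n : ℕ, ∫ t in (0 : ℝ)..T, t ^ n * g t = 0) :
    ∀ᵐ t : ℝ, t ∈ Set.Ioo 0 T → g t = 0 := by
  have hpolyInt (q : ℝ → ℝ) (hq : Continuous q) :
      IntervalIntegrable (fun t => q t * g t) volume 0 T :=
    hg.continuousOn_mul hq.continuousOn
  have hpoly (p : Polynomial ℝ) : ∫ t in (0 : ℝ)..T, p.eval t * g t = 0 := by
    simp_rw [Polynomial.eval_eq_sum_range, Finset.sum_mul]
    rw [intervalIntegral.integral_finsetSum]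
    · refine Finset.sum_eq_zero fun i _ => ?_
      simp_rw [mul_assoc]
      rw [intervalIntegral.integral_const_mul, hmom, mul_zero]
    · exact fun i _ => hpolyInt (fun t => p.coeff i * t ^ i) (by fun_prop)
  refine isOpen_Ioo.ae_eq_zero_of_integral_contDiff_smul_eq_zero ?_ ?_
  · exact (((intervalIntegrable_iff_integrableOn_Ioc_of_le hT.le).1 hg).mono_set
      Set.Ioo_subset_Ioc_self).locallyIntegrableOn
  intro q hq _ hqsupp
  have hset : ∫ t, q t • g t = ∫ t in (0 : ℝ)..T, q t * g t := by
    rw [intervalIntegral.integral_of_le hT.le, setIntegral_eq_integral_of_forall_compl_eq_zero]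
    · rfl
    · intro t ht
      have : q t = 0 := by
        by_contra h
        exact ht (Set.Ioo_subset_Ioc_self (hqsupp (subset_tsupport q h)))
      simp [this]
  rw [hset]
  have hC : 0 ≤ ∫ t in (0 : ℝ)..T, |g t| :=
    intervalIntegral.integral_nonneg hT.le fun t _ => abs_nonneg _
  set C := ∫ t in (0 : ℝ)..T, |g t|
  rw [← abs_eq_zero]
  refine le_antisymm (le_of_forall_pos_le_add fun ε hε => ?_) (abs_nonneg _)
  have hδ : 0 < ε / (C + 1) := by positivity
  obtain ⟨p, hp⟩ := exists_polynomial_near_of_continuousOn 0 T q hq.continuous.continuousOn _ hδ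
  have hsub : ∫ t in (0 : ℝ)..T, q t * g t = ∫ t in (0 : ℝ)..T, (q t - p.eval t) * g t := by
    simp_rw [sub_mul]
    rw [intervalIntegral.integral_sub (hpolyInt _ hq.continuous) (hpolyInt _ p.continuous),
      hpoly, sub_zero]
  calc |∫ t in (0 : ℝ)..T, q t * g t|
      ≤ ∫ t in (0 : ℝ)..T, |(q t - p.eval t) * g t| := by
        rw [hsub]; exact intervalIntegral.abs_integral_le_integral_abs hT.le
    _ ≤ ∫ t in (0 : ℝ)..T, ε / (C + 1) * |g t| := by
        refine intervalIntegral.integral_mono_on hT.le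
          (hpolyInt (fun t => q t - p.eval t) (hq.continuous.sub p.continuous)).abs
          (hg.abs.const_mul _) fun t ht => ?_
        rw [abs_mul, abs_sub_comm]
        exact mul_le_mul_of_nonneg_right (hp t ht).le (abs_nonneg _)
    _ = ε / (C + 1) * C := intervalIntegral.integral_const_mul _ _
    _ ≤ 0 + ε := by
        rw [zero_add, div_mul_eq_mul_div, div_le_iff₀ (by positivity)]
        nlinarith

/-- A function that is a.e. the primitive of some `h` with `|h| ≤ L |w|` vanishes a.e. -/
theorem ae_eq_zero_of_ae_eq_integral {T L : ℝ} (hT : 0 < T) {w h : ℝ → ℝ}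
    (hh : IntervalIntegrable h volume 0 T) (hL : ∀ t, |h t| ≤ L * |w t|)
    (hw : ∀ᵐ t : ℝ, t ∈ Set.Ioo 0 T → w t = ∫ s in (0 : ℝ)..t, h s) :
    ∀ᵐ t : ℝ, t ∈ Set.Ioo 0 T → w t = 0 := by
  set H : ℝ → ℝ := fun t => ∫ s in (0 : ℝ)..t, h s with hH
  have hHcont : ContinuousOn H (Set.Icc 0 T) := by
    have := intervalIntegral.continuousOn_primitive_interval' hh Set.left_mem_uIcc
    rwa [Set.uIcc_of_le hT.le] at this
  have hHabs : IntervalIntegrable (fun s => |H s|) volume 0 T :=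
    ContinuousOn.intervalIntegrable (by rw [Set.uIcc_of_le hT.le]; exact hHcont.abs)
  set K : ℝ → ℝ := fun t => ∫ s in (0 : ℝ)..t, |H s| with hK
  have hKcont : ContinuousOn K (Set.Icc 0 T) := by
    have := intervalIntegral.continuousOn_primitive_interval' hHabs Set.left_mem_uIcc
    rwa [Set.uIcc_of_le hT.le] at this
  have hHK (t : ℝ) (ht : t ∈ Set.Icc 0 T) : |H t| ≤ L * K t := by
    have hsub : Set.uIcc 0 t ⊆ Set.uIcc 0 T := by
      rw [Set.uIcc_of_le ht.1, Set.uIcc_of_le hT.le]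
      exact Set.Icc_subset_Icc_right ht.2
    calc |H t| ≤ ∫ s in (0 : ℝ)..t, |h s| := intervalIntegral.abs_integral_le_integral_abs ht.1
      _ ≤ ∫ s in (0 : ℝ)..t, L * |H s| := by
        refine intervalIntegral.integral_mono_ae_restrict ht.1 (hh.mono_set hsub).abs
          ((hHabs.mono_set hsub).const_mul L) ?_
        rw [← restrict_Ioo_eq_restrict_Icc, EventuallyLE, ae_restrict_iff' measurableSet_Ioo]
        filter_upwards [hw] with s hs hst
        have hws : w s = H s := hs ⟨hst.1, hst.2.trans_le ht.2⟩
        rw [← hws]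
        exact hL s
      _ = L * K t := intervalIntegral.integral_const_mul _ _
  have hKzero := norm_le_gronwallBound_of_norm_deriv_right_le (f := K) (f' := fun t => |H t|)
    (δ := 0) (K := L) (ε := 0) (a := 0) (b := T) hKcont (fun t ht => ?_) (by simp [hK])
    (fun t ht => ?_)
  · filter_upwards [hw] with t ht hmem
    have hK0 := hKzero t ⟨hmem.1.le, hmem.2.le⟩
    rw [gronwallBound_ε0_δ0, norm_le_zero_iff] at hK0
    have := hHK t ⟨hmem.1.le, hmem.2.le⟩
    rw [hK0, mul_zero] at this
    rw [ht hmem]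
    exact abs_nonpos_iff.1 this
  · have hnhds : Set.Icc 0 T ∈ nhdsWithin t (Set.Ici t) :=
      mem_of_superset (Icc_mem_nhdsGE ht.2) (Set.Icc_subset_Icc_left ht.1)
    have hcw : ContinuousWithinAt (fun s => |H s|) (Set.Ici t) t :=
      (hHcont.abs t ⟨ht.1, ht.2.le⟩).mono_of_mem_nhdsWithin hnhds
    refine intervalIntegral.integral_hasDerivWithinAt_right (s := Set.Ici t) (t := Set.Ioi t) ?_ ?_
      (hcw.mono Set.Ioi_subset_Ici_self)
    · refine hHabs.mono_set ?_
      rw [Set.uIcc_of_le ht.1, Set.uIcc_of_le hT.le]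
      exact Set.Icc_subset_Icc_right ht.2.le
    · exact ⟨Set.Icc 0 T, nhdsWithin_mono _ Set.Ioi_subset_Ici_self hnhds,
        (hHcont.abs).aestronglyMeasurable measurableSet_Icc⟩
  · have := hHK t ⟨ht.1, ht.2.le⟩
    have hKnn : 0 ≤ K t := intervalIntegral.integral_nonneg ht.1 fun _ _ => abs_nonneg _
    simpa [abs_of_nonneg hKnn] using this

/-- Uniqueness for the weak form of the linear problem `w' = h`, `w(0) = 0`, `|h| ≤ L |w|`. -/
theorem ae_eq_zero_of_weak_ode {T L : ℝ} (hT : 0 < T) {w h : ℝ → ℝ}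
    (hwi : IntervalIntegrable w volume 0 T) (hh : IntervalIntegrable h volume 0 T)
    (hL : ∀ t, |h t| ≤ L * |w t|)
    (hweak : ∀ n : ℕ, ∫ t in (0 : ℝ)..T,
      (w t * ((n + 1) * t ^ n) + h t * (t ^ (n + 1) - T ^ (n + 1))) = 0) :
    ∀ᵐ t : ℝ, t ∈ Set.Ioo 0 T → w t = 0 := by
  have hHac := hh.absolutelyContinuousOnInterval_intervalIntegral (c := 0) Set.left_mem_uIcc
  have hHi : IntervalIntegrable (fun t => ∫ s in (0 : ℝ)..t, h s) volume 0 T :=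
    hHac.continuousOn.intervalIntegrable
  refine ae_eq_zero_of_ae_eq_integral hT hh hL ?_
  have hzero := ae_eq_zero_of_moments_eq_zero hT (hwi.sub hHi) fun n => ?_
  · filter_upwards [hzero] with t ht hmem using sub_eq_zero.1 (ht hmem)
  have hderiv (t : ℝ) : deriv (fun t : ℝ => t ^ (n + 1) - T ^ (n + 1)) t = (n + 1) * t ^ n := by
    simp
  have hparts := hHac.integral_mul_deriv_eq_deriv_mul (g := fun t => t ^ (n + 1) - T ^ (n + 1))
    (ContDiffOn.absolutelyContinuousOnInterval (by fun_prop))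
  have hswap : ∫ t in (0 : ℝ)..T, deriv (fun t => ∫ s in (0 : ℝ)..t, h s) t *
      (t ^ (n + 1) - T ^ (n + 1)) = ∫ t in (0 : ℝ)..T, h t * (t ^ (n + 1) - T ^ (n + 1)) := by
    refine intervalIntegral.integral_congr_ae ?_
    filter_upwards [hh.ae_hasDerivAt_integral] with t ht hmem
    rw [(ht (Set.uIoc_subset_uIcc hmem) 0 Set.left_mem_uIcc).deriv]
  simp_rw [hderiv] at hparts
  rw [hswap] at hparts
  simp only [sub_self, mul_zero, intervalIntegral.integral_same, zero_mul, zero_sub] at hparts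
  have hi1 : IntervalIntegrable (fun t => w t * ((n + 1) * t ^ n)) volume 0 T :=
    hwi.mul_continuousOn (by fun_prop)
  have hi2 : IntervalIntegrable (fun t => h t * (t ^ (n + 1) - T ^ (n + 1))) volume 0 T :=
    hh.mul_continuousOn (by fun_prop)
  have hi3 : IntervalIntegrable (fun t => (∫ s in (0 : ℝ)..t, h s) * ((n + 1) * t ^ n))
      volume 0 T := hHi.mul_continuousOn (by fun_prop)
  have hn := hweak n
  rw [intervalIntegral.integral_add hi1 hi2, ← sub_neg_eq_add, ← hparts,
    ← intervalIntegral.integral_sub hi1 hi3] at hn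
  have hfac : ∀ t, w t * ((n + 1) * t ^ n) - (∫ s in (0 : ℝ)..t, h s) * ((n + 1) * t ^ n)
      = ((n : ℝ) + 1) * (t ^ n * (w t - ∫ s in (0 : ℝ)..t, h s)) := fun t => by ring
  simp_rw [hfac] at hn
  rw [intervalIntegral.integral_const_mul] at hn
  exact (mul_eq_zero.1 hn).resolve_left (by positivity)

/-- A product of a cut-off in time and a cut-off transported along characteristics is a test
function. -/
theorem isTestFn_mul_transport {lam T : ℝ} {φ χ : ℝ → ℝ}
    (hφ : ContDiff ℝ (⊤ : ℕ∞) φ) (hφc : HasCompactSupport φ) (hφT : φ T = 0)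
    (hχ : ContDiff ℝ (⊤ : ℕ∞) χ) (hχc : HasCompactSupport χ) :
    IsTestFn T (fun t x => φ t * χ (x - lam * t)) := by
  refine ⟨?_, ?_, fun x => by simp [hφT]⟩
  · exact (hφ.comp contDiff_fst).mul
      (hχ.comp (contDiff_snd.sub (contDiff_const.mul contDiff_fst)))
  · refine HasCompactSupport.intro (K := (fun p : ℝ × ℝ => (p.1, p.2 + lam * p.1)) ''
      (tsupport φ ×ˢ tsupport χ))
      ((hφc.isCompact.prod hχc.isCompact).image (by fun_prop)) fun p hp => ?_
    by_contra hne
    have hne' : φ p.1 * χ (p.2 - lam * p.1) ≠ 0 := hne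
    exact hp ⟨(p.1, p.2 - lam * p.1), ⟨subset_tsupport _ (left_ne_zero_of_mul hne'),
      subset_tsupport _ (right_ne_zero_of_mul hne')⟩, by simp⟩

/-- A bounded measurable function times a cut-off in space is integrable on a time strip. -/
theorem integrable_bounded_mul_cutoff {T M : ℝ} {F : ℝ → ℝ → ℝ} {χ : ℝ → ℝ}
    (hF : Measurable (Function.uncurry F))
    (hM : ∀ t ∈ Set.uIoc 0 T, ∀ y, |F t y| ≤ M) (hχ : Continuous χ) (hχc : HasCompactSupport χ) :
    Integrable (Function.uncurry fun t y => F t y * χ y)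
      ((volume.restrict (Set.uIoc 0 T)).prod volume) := by
  have : IsFiniteMeasure (volume.restrict (Set.uIoc 0 T)) := ⟨by simp [Set.uIoc]⟩
  have hχi : Integrable (fun p : ℝ × ℝ => χ p.2)
      ((volume.restrict (Set.uIoc 0 T)).prod volume) :=
    (hχ.integrable_of_hasCompactSupport hχc).comp_snd _
  refine hχi.bdd_mul (c := M) hF.aestronglyMeasurable ?_
  refine (Measure.ae_prod_iff_ae_ae (measurableSet_le hF.norm measurable_const)).2 ?_
  filter_upwards [ae_restrict_mem measurableSet_uIoc] with t ht
  exact Eventually.of_forall (hM t ht)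

/-- The integrand of the weak formulation at time `t` on the characteristic issuing from `y`, for
a test function whose time factor is `φ`. -/
noncomputable def charIntegrand (lam μ : ℝ) (u : ℝ → ℝ → ℝ) (φ : ℝ → ℝ) (t y : ℝ) : ℝ :=
  u t (y + lam * t) * deriv φ t + μ * u t (y + lam * t) * (1 - u t (y + lam * t)) * φ t

theorem measurable_along_characteristics {lam : ℝ} {u : ℝ → ℝ → ℝ}
    (hu : Measurable (Function.uncurry u)) :
    Measurable fun p : ℝ × ℝ => u p.1 (p.2 + lam * p.1) :=
  hu.comp (measurable_fst.prodMk (measurable_snd.add (measurable_fst.const_mul lam)))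

theorem measurable_charIntegrand {lam μ : ℝ} {u : ℝ → ℝ → ℝ} {φ : ℝ → ℝ}
    (hu : Measurable (Function.uncurry u)) (hφ : ContDiff ℝ (⊤ : ℕ∞) φ) :
    Measurable (Function.uncurry (charIntegrand lam μ u φ)) := by
  have hU := measurable_along_characteristics (lam := lam) hu
  exact (hU.mul ((measurable_deriv φ).comp measurable_fst)).add
    (((hU.const_mul μ).mul (hU.const_sub 1)).mul (hφ.continuous.measurable.comp measurable_fst))

theorem exists_bound_charIntegrand {lam μ T M : ℝ} {u : ℝ → ℝ → ℝ} {φ : ℝ → ℝ}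
    (hM : ∀ t x, |u t x| ≤ M) (hφ : ContDiff ℝ (⊤ : ℕ∞) φ) :
    ∃ C, ∀ t ∈ Set.uIcc 0 T, ∀ y, |charIntegrand lam μ u φ t y| ≤ C := by
  have hdφ : Continuous (deriv φ) := hφ.continuous_deriv (by norm_cast)
  obtain ⟨A, hA⟩ := (isCompact_uIcc (a := (0 : ℝ)) (b := T)).exists_bound_of_continuousOn
    hdφ.continuousOn
  obtain ⟨B, hB⟩ := (isCompact_uIcc (a := (0 : ℝ)) (b := T)).exists_bound_of_continuousOn
    hφ.continuous.continuousOn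
  refine ⟨M * A + |μ| * M * (1 + M) * B, fun t ht y => ?_⟩
  have hA' := hA t ht
  have hB' := hB t ht
  have hM' := hM t (y + lam * t)
  have hM0 := (abs_nonneg _).trans hM'
  rw [Real.norm_eq_abs] at hA' hB'
  have h1 : |1 - u t (y + lam * t)| ≤ 1 + M :=
    (abs_sub _ _).trans (by rw [abs_one]; gcongr)
  refine (abs_add_le _ _).trans ?_
  simp only [abs_mul]
  gcongr

/-- The weak formulation, written in characteristic coordinates `y = x - λ t`. -/
theorem IsWeakSolution.integral_characteristics {lam μ T : ℝ} (hT : 0 < T) {ψ : ℝ → ℝ}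
    {u : ℝ → ℝ → ℝ} (hu : IsWeakSolution lam μ T ψ u) {φ χ : ℝ → ℝ}
    (hφ : ContDiff ℝ (⊤ : ℕ∞) φ) (hφT : φ T = 0)
    (hχ : ContDiff ℝ (⊤ : ℕ∞) χ) (hχc : HasCompactSupport χ) :
    ∫ y, χ y * ∫ t in (0 : ℝ)..T, charIntegrand lam μ u φ t y
      = -∫ y, ψ y * (φ 0 * χ y) := by
  obtain ⟨⟨M, hM⟩, hmeas, hweak⟩ := hu
  let η : ContDiffBump (0 : ℝ) := ⟨T + 1, T + 2, by linarith, by linarith⟩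
  have hη (t : ℝ) (ht : t ∈ Set.Icc 0 T) : (fun s => η s * φ s) =ᶠ[nhds t] φ := by
    have : t ∈ Metric.ball (0 : ℝ) η.rIn := by
      rw [mem_ball_zero_iff, Real.norm_eq_abs, abs_of_nonneg ht.1]
      exact ht.2.trans_lt (lt_add_one T)
    filter_upwards [η.eventuallyEq_one_of_mem_ball this] with s hs
    simp [hs]
  have hηφ : ContDiff ℝ (⊤ : ℕ∞) (fun s => η s * φ s) := η.contDiff.mul hφ
  have h := hweak _ (isTestFn_mul_transport (lam := lam) (T := T) hηφ
    η.hasCompactSupport.mul_right (by simp [hφT]) hχ hχc)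
  have h0 : η 0 * φ 0 = φ 0 := (hη 0 ⟨le_rfl, hT.le⟩).self_of_nhds
  simp only [mul_zero, sub_zero, h0] at h
  rw [← eq_neg_iff_add_eq_zero] at h
  rw [← h]
  obtain ⟨C, hC⟩ := exists_bound_charIntegrand (lam := lam) (μ := μ) (T := T) hM hφ
  have hint := integrable_bounded_mul_cutoff
    (measurable_charIntegrand (lam := lam) (μ := μ) hmeas hφ)
    (fun t ht => hC t (Set.uIoc_subset_uIcc ht)) hχ.continuous hχc
  calc ∫ y, χ y * ∫ t in (0 : ℝ)..T, charIntegrand lam μ u φ t y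
      = ∫ y, ∫ t in (0 : ℝ)..T, charIntegrand lam μ u φ t y * χ y := by
        simp_rw [intervalIntegral.integral_mul_const, mul_comm (χ _)]
    _ = ∫ t in (0 : ℝ)..T, ∫ y, charIntegrand lam μ u φ t y * χ y :=
        (intervalIntegral_integral_swap hint).symm
    _ = _ := by
      refine intervalIntegral.integral_congr fun t ht => ?_
      rw [Set.uIcc_of_le hT.le] at ht
      have hval : η t * φ t = φ t := (hη t ht).self_of_nhds
      have hder : HasDerivAt (fun s => η s * φ s) (deriv φ t) t :=
        ((hφ.differentiable (by simp)) t).hasDerivAt.congr_of_eventuallyEq (hη t ht)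
      have hdχ (y : ℝ) : HasDerivAt χ (deriv χ y) y := ((hχ.differentiable (by simp)) y).hasDerivAt
      change ∫ y, charIntegrand lam μ u φ t y * χ y = _
      rw [← integral_sub_right_eq_self _ (lam * t)]
      refine integral_congr_ae (Eventually.of_forall fun x => ?_)
      have hlin : HasDerivAt (fun s : ℝ => x - lam * s) (-lam) t := by
        simpa using ((hasDerivAt_id t).const_mul lam).const_sub x
      have ht1 : deriv (fun s => η s * φ s * χ (x - lam * s)) t =
          deriv φ t * χ (x - lam * t) + φ t * (deriv χ (x - lam * t) * -lam) := by
        have := hder.mul ((hdχ (x - lam * t)).comp t hlin)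
        rw [hval] at this
        exact this.deriv
      have hx1 : deriv (fun y => φ t * χ (y - lam * t)) x =
          φ t * deriv χ (x - lam * t) := by
        have := ((hdχ (x - lam * t)).comp x ((hasDerivAt_id x).sub_const (lam * t))).const_mul (φ t)
        simpa using this.deriv
      simp only [ht1, hx1, hval, charIntegrand, sub_add_cancel]
      ring

theorem IsWeakSolution.locallyIntegrable_integral_charIntegrand {lam μ T : ℝ} {ψ : ℝ → ℝ}
    {u : ℝ → ℝ → ℝ} (hu : IsWeakSolution lam μ T ψ u) {φ : ℝ → ℝ}
    (hφ : ContDiff ℝ (⊤ : ℕ∞) φ) :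
    LocallyIntegrable (fun y => ∫ t in (0 : ℝ)..T, charIntegrand lam μ u φ t y) := by
  obtain ⟨⟨M, hM⟩, hmeas, -⟩ := hu
  obtain ⟨C, hC⟩ := exists_bound_charIntegrand (lam := lam) (μ := μ) (T := T) hM hφ
  have hF := (measurable_charIntegrand (lam := lam) (μ := μ) hmeas hφ).stronglyMeasurable
  refine (locallyIntegrable_const (C * |T - 0|)).mono ?_ (Eventually.of_forall fun y => ?_)
  · unfold intervalIntegral
    exact (hF.integral_prod_left.sub hF.integral_prod_left).aestronglyMeasurable
  · exact (intervalIntegral.norm_integral_le_of_norm_le_const fun t ht =>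
      hC t (Set.uIoc_subset_uIcc ht) y).trans (le_abs_self _)

/-- Along almost every characteristic, two weak solutions satisfy the same weak form against a
given function of time. -/
theorem IsWeakSolution.ae_integral_charIntegrand_eq {lam μ T : ℝ} (hT : 0 < T) {ψ : ℝ → ℝ}
    {u v : ℝ → ℝ → ℝ} (hu : IsWeakSolution lam μ T ψ u) (hv : IsWeakSolution lam μ T ψ v)
    {φ : ℝ → ℝ} (hφ : ContDiff ℝ (⊤ : ℕ∞) φ) (hφT : φ T = 0) :
    ∀ᵐ y, ∫ t in (0 : ℝ)..T, charIntegrand lam μ u φ t y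
      = ∫ t in (0 : ℝ)..T, charIntegrand lam μ v φ t y := by
  refine ae_eq_of_integral_contDiff_smul_eq (hu.locallyIntegrable_integral_charIntegrand hφ)
    (hv.locallyIntegrable_integral_charIntegrand hφ) fun χ hχ hχc => ?_
  simp only [smul_eq_mul]
  rw [hu.integral_characteristics hT hφ hφT hχ hχc, hv.integral_characteristics hT hφ hφT hχ hχc]

/-- Two weak solutions agree almost everywhere on almost every characteristic. -/
theorem IsWeakSolution.ae_ae_eq_along_characteristics {lam μ T : ℝ} (hT : 0 < T) {ψ : ℝ → ℝ}
    {u v : ℝ → ℝ → ℝ} (hu : IsWeakSolution lam μ T ψ u) (hv : IsWeakSolution lam μ T ψ v) :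
    ∀ᵐ y, ∀ᵐ t, t ∈ Set.Ioo 0 T → u t (y + lam * t) = v t (y + lam * t) := by
  have hφ (n : ℕ) : ContDiff ℝ (⊤ : ℕ∞) (fun t : ℝ => t ^ (n + 1) - T ^ (n + 1)) := by fun_prop
  have hall := ae_all_iff.2 fun n : ℕ => hu.ae_integral_charIntegrand_eq hT hv (hφ n) (sub_self _)
  obtain ⟨⟨M, hM⟩, hum, -⟩ := hu
  obtain ⟨⟨N, hN⟩, hvm, -⟩ := hv
  filter_upwards [hall] with y hy
  have hUm : Measurable fun t => u t (y + lam * t) :=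
    (measurable_along_characteristics hum).comp (measurable_id.prodMk measurable_const)
  have hVm : Measurable fun t => v t (y + lam * t) :=
    (measurable_along_characteristics hvm).comp (measurable_id.prodMk measurable_const)
  have hInt {g : ℝ → ℝ} (hg : Measurable g) {C : ℝ} (hC : ∀ t, |g t| ≤ C) :
      IntervalIntegrable g volume 0 T :=
    (intervalIntegrable_const (c := C)).mono_fun hg.aestronglyMeasurable
      (Eventually.of_forall fun t => (hC t).trans (le_abs_self C))
  have hw : IntervalIntegrable (fun t => u t (y + lam * t) - v t (y + lam * t)) volume 0 T :=
    (hInt hUm fun t => hM _ _).sub (hInt hVm fun t => hN _ _)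
  set L := |μ| * (1 + M + N)
  have hfac (a b : ℝ) (ha : |a| ≤ M) (hb : |b| ≤ N) :
      |μ * a * (1 - a) - μ * b * (1 - b)| ≤ L * |a - b| := by
    have hb1 : |1 - a - b| ≤ 1 + M + N := by
      calc |1 - a - b| ≤ |1 - a| + |b| := abs_sub _ _
        _ ≤ |1| + |a| + |b| := by gcongr; exact abs_sub _ _
        _ ≤ 1 + M + N := by rw [abs_one]; gcongr
    have : μ * a * (1 - a) - μ * b * (1 - b) = μ * (1 - a - b) * (a - b) := by ring
    rw [this, abs_mul, abs_mul]
    exact mul_le_mul_of_nonneg_right (mul_le_mul_of_nonneg_left hb1 (abs_nonneg μ)) (abs_nonneg _)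
  have hh : IntervalIntegrable (fun t => μ * u t (y + lam * t) * (1 - u t (y + lam * t))
      - μ * v t (y + lam * t) * (1 - v t (y + lam * t))) volume 0 T := by
    refine (hw.abs.const_mul L).mono_fun ?_ (Eventually.of_forall fun t => ?_)
    · exact (((hUm.const_mul μ).mul (hUm.const_sub 1)).sub
        ((hVm.const_mul μ).mul (hVm.const_sub 1))).aestronglyMeasurable
    · exact (hfac _ _ (hM _ _) (hN _ _)).trans (le_abs_self _)
  have hzero := ae_eq_zero_of_weak_ode hT hw hh (fun t => hfac _ _ (hM _ _) (hN _ _)) fun n => ?_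
  · filter_upwards [hzero] with t ht hmem using sub_eq_zero.1 (ht hmem)
  obtain ⟨C, hC⟩ := exists_bound_charIntegrand (lam := lam) (μ := μ) (T := T) hM (hφ n)
  obtain ⟨D, hD⟩ := exists_bound_charIntegrand (lam := lam) (μ := μ) (T := T) hN (hφ n)
  have hInt' {u : ℝ → ℝ → ℝ} (hu : Measurable (Function.uncurry u)) {C : ℝ}
      (hC : ∀ t ∈ Set.uIcc 0 T, ∀ y,
        |charIntegrand lam μ u (fun t => t ^ (n + 1) - T ^ (n + 1)) t y| ≤ C) :
      IntervalIntegrable (fun t => charIntegrand lam μ u (fun t => t ^ (n + 1) - T ^ (n + 1)) t y)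
        volume 0 T := by
    refine (intervalIntegrable_const (c := C)).mono_fun ?_ ?_
    · exact ((measurable_charIntegrand hu (hφ n)).comp
        (measurable_id.prodMk measurable_const)).aestronglyMeasurable
    · filter_upwards [ae_restrict_mem measurableSet_uIoc] with t ht
      exact (hC t (Set.uIoc_subset_uIcc ht) y).trans (le_abs_self C)
  refine Eq.trans ?_ (sub_eq_zero.2 (hy n))
  rw [← intervalIntegral.integral_sub (hInt' hum hC) (hInt' hvm hD)]
  refine intervalIntegral.integral_congr fun t _ => ?_
  simp [charIntegrand]
  ring

/-- uniqueness of bounded measurable weak solutions of the Cauchy problem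
`u_t = −λ u_x + μ(u² − u)`, `u(0,·) = ψ`, on `[0,T] × ℝ` (a.e. equality). -/
theorem statement8 (lam μ T : ℝ) (hμ : 0 < μ) (hT : 0 < T)
    (ψ : ℝ → ℝ) (hψ_meas : Measurable ψ) (hψ_bdd : ∃ M : ℝ, ∀ x, |ψ x| ≤ M)
    (u v : ℝ → ℝ → ℝ)
    (hu : IsWeakSolution lam μ T ψ u) (hv : IsWeakSolution lam μ T ψ v) :
    ∀ᵐ p : ℝ × ℝ ∂(volume.restrict (Set.Icc 0 T ×ˢ Set.univ)),
      u p.1 p.2 = v p.1 p.2 := by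
  have hset : MeasurableSet {p : ℝ × ℝ | p.1 ∈ Set.Ioo 0 T →
      u p.1 (p.2 + lam * p.1) = v p.1 (p.2 + lam * p.1)} :=
    (measurable_fst measurableSet_Ioo).imp (measurableSet_eq_fun
      (measurable_along_characteristics hu.2.1) (measurable_along_characteristics hv.2.1))
  have hae := (Measure.ae_ae_comm (μ := volume) (ν := volume)
    (p := fun t y => t ∈ Set.Ioo 0 T → u t (y + lam * t) = v t (y + lam * t)) hset).2
    (hu.ae_ae_eq_along_characteristics hT hv)
  rw [Measure.volume_eq_prod, ← Measure.prod_restrict, Measure.restrict_univ,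
    ← restrict_Ioo_eq_restrict_Icc,
    Measure.ae_prod_iff_ae_ae (p := fun p : ℝ × ℝ => u p.1 p.2 = v p.1 p.2)
      (measurableSet_eq_fun hu.2.1 hv.2.1), ae_restrict_iff' measurableSet_Ioo]
  filter_upwards [hae] with t ht hmem
  filter_upwards [(measurePreserving_sub_right volume (lam * t)).quasiMeasurePreserving.ae ht]
    with x hx
  simpa using hx hmem
end

section
/- Let λ ∈ ℝ, μ > 0, and let ψ : ℝ → [0,1] be continuously differentiable. Then the function u_ψ(t,x) = ψ(x − λt) e^{−μt} / (1 − ψ(x − λt) + ψ(x − λt) e^{−μt}) is continuously differentiable on [0,∞) × ℝ, satisfies u_ψ(0,x) = ψ(x) for all x, takes values in [0,1], and is a classical solution of the equation (u_ψ)_t(t,x) = −λ (u_ψ)_x(t,x) + μ (u_ψ(t,x)² − u_ψ(t,x)) for all t > 0, x ∈ ℝ. -/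
open Filter

/-- The explicit solution `u_ψ(t,x) = ψ(x−λt)e^{−μt} / (1 − ψ(x−λt) + ψ(x−λt)e^{−μt})`. -/
noncomputable def uPsi (lam μ : ℝ) (ψ : ℝ → ℝ) (t x : ℝ) : ℝ :=
  ψ (x - lam * t) * Real.exp (-μ * t) /
    (1 - ψ (x - lam * t) + ψ (x - lam * t) * Real.exp (-μ * t))

lemma one_sub_add_mul_pos {a e : ℝ} (ha : a ∈ Set.Icc (0 : ℝ) 1) (he : 0 < e) :
    0 < 1 - a + a * e := by
  rcases ha.1.eq_or_lt with rfl | h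
  · norm_num
  · linarith [ha.2, mul_pos h he]

lemma uPsi_hasDerivAt_time {lam μ : ℝ} {ψ : ℝ → ℝ} {t x : ℝ}
    (hψ : DifferentiableAt ℝ ψ (x - lam * t)) (hψ01 : ψ (x - lam * t) ∈ Set.Icc (0 : ℝ) 1) :
    HasDerivAt (fun s => uPsi lam μ ψ s x)
      (-lam * (deriv ψ (x - lam * t) * Real.exp (-μ * t) /
          (1 - ψ (x - lam * t) + ψ (x - lam * t) * Real.exp (-μ * t)) ^ 2) +
        μ * ((uPsi lam μ ψ t x) ^ 2 - uPsi lam μ ψ t x)) t := by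
  have hD := (one_sub_add_mul_pos hψ01 (Real.exp_pos (-μ * t))).ne'
  have hlin : HasDerivAt (fun s : ℝ => x - lam * s) (-lam) t := by
    simpa using ((hasDerivAt_id t).const_mul lam).const_sub x
  have hφ : HasDerivAt (fun s => ψ (x - lam * s)) (deriv ψ (x - lam * t) * -lam) t :=
    hψ.hasDerivAt.comp t hlin
  have hE : HasDerivAt (fun s : ℝ => Real.exp (-μ * s)) (Real.exp (-μ * t) * -μ) t := by
    simpa using ((hasDerivAt_id t).const_mul (-μ)).exp
  refine ((hφ.mul hE).div ((hφ.const_sub 1).add (hφ.mul hE)) hD).congr_deriv ?_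
  simp only [uPsi, Pi.add_apply, Pi.mul_apply]
  field_simp
  ring

lemma uPsi_hasDerivAt_space {lam μ : ℝ} {ψ : ℝ → ℝ} {t x : ℝ}
    (hψ : DifferentiableAt ℝ ψ (x - lam * t)) (hψ01 : ψ (x - lam * t) ∈ Set.Icc (0 : ℝ) 1) :
    HasDerivAt (fun y => uPsi lam μ ψ t y)
      (deriv ψ (x - lam * t) * Real.exp (-μ * t) /
        (1 - ψ (x - lam * t) + ψ (x - lam * t) * Real.exp (-μ * t)) ^ 2) x := by
  have hD := (one_sub_add_mul_pos hψ01 (Real.exp_pos (-μ * t))).ne'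
  have hφ : HasDerivAt (fun y => ψ (y - lam * t)) (deriv ψ (x - lam * t)) x :=
    hψ.hasDerivAt.comp_sub_const x (lam * t)
  have hφE := hφ.mul_const (Real.exp (-μ * t))
  refine (hφE.div ((hφ.const_sub 1).add hφE) hD).congr_deriv ?_
  simp only [Pi.add_apply]
  congr 1
  ring

/-- for `ψ ∈ C¹` with values in `[0,1]`, the function `u_ψ` is a classical
solution of `u_t = −λ u_x + μ(u² − u)` with `u(0,·) = ψ`, taking values in `[0,1]`. -/
theorem statement10 (lam μ : ℝ) (hμ : 0 < μ) (ψ : ℝ → ℝ)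
    (hψ_C1 : ContDiff ℝ 1 ψ) (hψ01 : ∀ x, ψ x ∈ Set.Icc (0 : ℝ) 1) :
    ContDiffOn ℝ 1 (fun p : ℝ × ℝ => uPsi lam μ ψ p.1 p.2)
      (Set.Ici 0 ×ˢ Set.univ) ∧
    (∀ x : ℝ, uPsi lam μ ψ 0 x = ψ x) ∧
    (∀ t x : ℝ, 0 ≤ t → uPsi lam μ ψ t x ∈ Set.Icc (0 : ℝ) 1) ∧
    ∀ t x : ℝ, 0 < t →
      deriv (fun s => uPsi lam μ ψ s x) t =
        -lam * deriv (fun y => uPsi lam μ ψ t y) x +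
          μ * ((uPsi lam μ ψ t x) ^ 2 - uPsi lam μ ψ t x) := by
  have hD (t x : ℝ) := one_sub_add_mul_pos (hψ01 (x - lam * t)) (Real.exp_pos (-μ * t))
  refine ⟨ContDiff.contDiffOn ?_, fun x => by simp [uPsi], fun t x _ => ⟨?_, ?_⟩,
    fun t x _ => ?_⟩
  · have hφ : ContDiff ℝ 1 (fun p : ℝ × ℝ => ψ (p.2 - lam * p.1)) :=
      hψ_C1.comp (by fun_prop)
    have hE : ContDiff ℝ 1 (fun p : ℝ × ℝ => Real.exp (-μ * p.1)) := by fun_prop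
    exact (hφ.mul hE).div ((contDiff_const.sub hφ).add (hφ.mul hE)) fun p => (hD p.1 p.2).ne'
  · exact div_nonneg (mul_nonneg (hψ01 _).1 (Real.exp_pos _).le) (hD t x).le
  · rw [uPsi, div_le_one (hD t x)]
    linarith [(hψ01 (x - lam * t)).2]
  · have hψ := hψ_C1.differentiable one_ne_zero (x - lam * t)
    rw [(uPsi_hasDerivAt_time hψ (hψ01 _)).deriv, (uPsi_hasDerivAt_space hψ (hψ01 _)).deriv]
end

section
/- Let λ ∈ ℝ, μ > 0, ν > 0 and C > 0. Let ψ ∈ H(ℝ) satisfy lim_{x→−∞} (1 − ψ(x)) e^{−νx} = C. Set v = λ − μ/ν and let u_ψ(t,x) = ψ(x − λt) e^{−μt} / (1 − ψ(x − λt) + ψ(x − λt) e^{−μt}). Then there exists x₀ ∈ ℝ (namely x₀ = −(ln C)/ν) such that for every y ∈ ℝ, lim_{t→+∞} u_ψ(t, y + vt) = w_v(y − x₀), where w_v(x) = (1 + exp(μ x / (λ − v)))^{-1} = (1 + e^{νx})^{-1}; i.e. the solution converges in the frame moving with speed v to the travelling wave w_v shifted by x₀. -/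
open Filter

/-- The class `H(ℝ)` of nonincreasing, right-continuous profiles tending to `1` at `−∞`
and to `0` at `+∞`. -/
def HR : Set (ℝ → ℝ) :=
  {ψ | Antitone ψ ∧ (∀ x : ℝ, ContinuousWithinAt ψ (Set.Ici x) x) ∧
       Tendsto ψ atBot (nhds 1) ∧ Tendsto ψ atTop (nhds 0)}

/-- The travelling-wave profile `w_v(x) = (1 + exp(μx/(λ−v)))⁻¹`. -/
noncomputable def wv (lam μ v : ℝ) (x : ℝ) : ℝ :=
  (1 + Real.exp (μ * x / (lam - v)))⁻¹

/-- if `1 − ψ(x) ∼ C e^{νx}` as `x → −∞`, then in the frame moving with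
speed `v = λ − μ/ν` the solution `u_ψ` converges pointwise to the shifted travelling
wave `w_v(· − x₀)` with `x₀ = −(ln C)/ν` (here `w_v(x) = (1 + e^{νx})⁻¹`). -/
theorem statement14 (lam μ ν C : ℝ) (hμ : 0 < μ) (hν : 0 < ν) (hC : 0 < C)
    (ψ : ℝ → ℝ) (hψ : ψ ∈ HR)
    (hasym : Tendsto (fun x => (1 - ψ x) * Real.exp (-ν * x)) atBot (nhds C)) :
    ∃ x₀ : ℝ, x₀ = -(Real.log C) / ν ∧
      ∀ y : ℝ,
        Tendsto (fun t => uPsi lam μ ψ t (y + (lam - μ / ν) * t)) atTop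
          (nhds (wv lam μ (lam - μ / ν) (y - x₀))) := by
  refine ⟨-(Real.log C) / ν, rfl, fun y => ?_⟩
  have hlim : wv lam μ (lam - μ / ν) (y - -(Real.log C) / ν) =
      1 * Real.exp (-ν * y) / (C + 1 * Real.exp (-ν * y)) := by
    have hexp : μ * (y - -(Real.log C) / ν) / (lam - (lam - μ / ν)) =
        Real.log C + ν * y := by
      rw [sub_sub_cancel]
      field_simp
      ring
    have hy : Real.exp (-ν * y) = (Real.exp (ν * y))⁻¹ := by
      rw [← Real.exp_neg, neg_mul]
    have := Real.exp_pos (ν * y)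
    rw [wv, hexp, Real.exp_add, Real.exp_log hC, hy]
    field_simp
    ring
  rw [hlim]
  have hz : Tendsto (fun t : ℝ => y - μ / ν * t) atTop atBot :=
    tendsto_atBot_add_const_left _ y
      (tendsto_neg_atTop_atBot.comp (tendsto_id.const_mul_atTop (div_pos hμ hν)))
  have hψz := hψ.2.2.1.comp hz
  have hnum := hψz.mul_const (Real.exp (-ν * y))
  have hden := (hasym.comp hz).add hnum
  refine (hnum.div hden (by positivity)).congr fun t => ?_
  have harg : y + (lam - μ / ν) * t - lam * t = y - μ / ν * t := by ring
  have hdecay : Real.exp (-ν * y) =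
      Real.exp (-μ * t) * Real.exp (-ν * (y - μ / ν * t)) := by
    rw [← Real.exp_add]
    congr 1
    field_simp
    ring
  simp only [uPsi, harg, Function.comp_apply, Pi.div_apply, hdecay]
  rw [← mul_assoc, ← add_mul, mul_div_mul_right _ _ (Real.exp_pos _).ne']
end

section
/- Let γ > 0 and μ > 0, and set v* = −√(4γμ). (a) For every v ≤ v* there exists a twice continuously differentiable function w : ℝ → ℝ with 0 ≤ w(x) ≤ 1 for all x, lim_{x→−∞} w(x) = 1, lim_{x→+∞} w(x) = 0, lim_{x→±∞} w'(x) = 0, satisfying γ w''(x) + v w'(x) + μ (w(x)² − w(x)) = 0 for all x ∈ ℝ (i.e. w is a travelling wave solution with speed v of u_t = γ u_xx + μ(u² − u)), and any two such functions are translates of each other: if w₁, w₂ both satisfy these conditions for the same v, then there is c ∈ ℝ with w₁(x) = w₂(x − c) for all x. (b) For every v > v* no function w with all these properties exists. -/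
open Filter

/-- `w` is a travelling-wave profile of speed `v` for the KPP equation
`u_t = γ u_xx + μ(u² − u)`, satisfying conditions U1 and U2:
`w` is `C²`, takes values in `[0,1]`, `w(−∞) = 1`, `w(+∞) = 0`, `w'(±∞) = 0`,
and solves the ODE `γ w'' + v w' + μ(w² − w) = 0`. -/
def IsKPPWave (γ μ v : ℝ) (w : ℝ → ℝ) : Prop :=
  ContDiff ℝ 2 w ∧
  (∀ x : ℝ, w x ∈ Set.Icc (0 : ℝ) 1) ∧
  Tendsto w atBot (nhds 1) ∧
  Tendsto w atTop (nhds 0) ∧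
  Tendsto (deriv w) atBot (nhds 0) ∧
  Tendsto (deriv w) atTop (nhds 0) ∧
  ∀ x : ℝ, γ * deriv (deriv w) x + v * deriv w x + μ * ((w x) ^ 2 - w x) = 0

open Set in
/-- A differentiable function which starts nonpositive and is nonincreasing wherever it is
positive stays nonpositive. -/
lemma nonpos_of_deriv_nonpos_of_pos {g g' : ℝ → ℝ} {a : ℝ} (hg : ∀ t, HasDerivAt g (g' t) t)
    (ha : g a ≤ 0) (h : ∀ t, a ≤ t → 0 < g t → g' t ≤ 0) : ∀ t, a ≤ t → g t ≤ 0 := by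
  intro b hb
  by_contra! hpos
  have hcont : Continuous g := continuous_iff_continuousAt.2 fun t => (hg t).continuousAt
  have hclosed : IsClosed (Icc a b ∩ g ⁻¹' Iic 0) := isClosed_Icc.inter (isClosed_Iic.preimage hcont)
  have hne : (Icc a b ∩ g ⁻¹' Iic 0).Nonempty := ⟨a, ⟨le_rfl, hb⟩, ha⟩
  have hbdd : BddAbove (Icc a b ∩ g ⁻¹' Iic 0) := ⟨b, fun x hx => hx.1.2⟩
  set s := sSup (Icc a b ∩ g ⁻¹' Iic 0) with hs
  obtain ⟨⟨has, hsb⟩, hgs⟩ := hclosed.csSup_mem hne hbdd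
  have hanti : AntitoneOn g (Icc s b) := by
    refine antitoneOn_of_deriv_nonpos (convex_Icc s b) hcont.continuousOn
      (fun t _ => (hg t).differentiableAt.differentiableWithinAt) fun t ht => ?_
    rw [interior_Icc] at ht
    rw [(hg t).deriv]
    refine h t (has.trans ht.1.le) ?_
    by_contra! hle
    exact ht.1.not_ge (le_csSup hbdd ⟨⟨has.trans ht.1.le, ht.2.le⟩, hle⟩)
  exact hpos.not_ge ((hanti ⟨le_rfl, hsb⟩ ⟨hsb, le_rfl⟩ hsb).trans hgs)

section IntegralCurves

variable {E : Type*} [NormedAddCommGroup E] [NormedSpace ℝ E] {f : E → E} {K : NNReal}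

open Set in
/-- A bounded Lipschitz autonomous vector field has integral curves defined for all times. -/
lemma exists_forall_hasDerivAt_of_lipschitzWith [CompleteSpace E] {L : NNReal}
    (hK : LipschitzWith K f) (hL : ∀ x, ‖f x‖ ≤ L) (x₀ : E) :
    ∃ α : ℝ → E, α 0 = x₀ ∧ ∀ t, HasDerivAt α (f (α t)) t := by
  have hloc (n : ℕ) : ∃ β : ℝ → E, β 0 = x₀ ∧
      ∀ t ∈ Ioo (-(n + 1 : ℝ)) (n + 1), HasDerivAt β (f (β t)) t := by
    have hn : (0 : ℝ) < n + 1 := by positivity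
    have hpl : IsPicardLindelof (fun _ : ℝ => f) (tmin := -(n + 1 : ℝ)) (tmax := n + 1)
        ⟨0, by linarith, hn.le⟩ x₀ (L * (n + 1)) 0 L K :=
      { lipschitzOnWith := fun t _ => hK.lipschitzOnWith
        continuousOn := fun x _ => continuousOn_const
        norm_le := fun t _ x _ => hL x
        mul_max_le := by simp }
    obtain ⟨β, hβ0, hβ⟩ := hpl.exists_eq_forall_mem_Icc_hasDerivWithinAt₀
    exact ⟨β, hβ0, fun t ht => (hβ t (Ioo_subset_Icc_self ht)).hasDerivAt (Icc_mem_nhds ht.1 ht.2)⟩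
  choose β hβ0 hβ using hloc
  have hmono (m n : ℕ) (hmn : m ≤ n) (t : ℝ) (ht : |t| < m + 1) : β m t = β n t := by
    have hmn' : (m : ℝ) ≤ n := by exact_mod_cast hmn
    have hm : (0 : ℝ) < m + 1 := by positivity
    refine ODE_solution_unique_of_mem_Ioo (v := fun _ => f) (s := fun _ => univ) (K := K)
      (a := -(m + 1 : ℝ)) (b := m + 1) (t₀ := 0)
      (fun _ _ => hK.lipschitzOnWith) ⟨by linarith, hm⟩ (fun s hs => ⟨hβ m s hs, trivial⟩)
      (fun s hs => ⟨hβ n s ⟨by linarith [hs.1], by linarith [hs.2]⟩, trivial⟩)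
      (by rw [hβ0, hβ0]) (abs_lt.1 ht)
  have heq (m n : ℕ) (t : ℝ) (hm : |t| < m + 1) (hn : |t| < n + 1) : β m t = β n t := by
    rcases le_total m n with h | h
    · exact hmono m n h t hm
    · exact (hmono n m h t hn).symm
  have hceil (t : ℝ) : |t| < (⌈|t|⌉₊ : ℝ) + 1 := (Nat.le_ceil _).trans_lt (lt_add_one _)
  refine ⟨fun t => β ⌈|t|⌉₊ t, hβ0 _, fun t => ?_⟩
  refine (hβ ⌈|t|⌉₊ t (abs_lt.1 (hceil t))).congr_of_eventuallyEq ?_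
  filter_upwards [continuous_abs.continuousAt.eventually_lt_const (hceil t)] with s hs
  exact heq _ _ s (hceil s) hs

/-- Integral curves of a Lipschitz vector field depend continuously on the initial value. -/
lemma dist_le_dist_mul_exp_of_lipschitzWith (hK : LipschitzWith K f) {α β : ℝ → E}
    (hα : ∀ t, HasDerivAt α (f (α t)) t) (hβ : ∀ t, HasDerivAt β (f (β t)) t) (t : ℝ) :
    dist (α t) (β t) ≤ dist (α 0) (β 0) * Real.exp (K * |t|) := by
  have forward {f : E → E} (hK : LipschitzWith K f) {α β : ℝ → E}
      (hα : ∀ t, HasDerivAt α (f (α t)) t) (hβ : ∀ t, HasDerivAt β (f (β t)) t) (t : ℝ)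
      (ht : 0 ≤ t) : dist (α t) (β t) ≤ dist (α 0) (β 0) * Real.exp (K * t) := by
    have := dist_le_of_trajectories_ODE (v := fun _ => f) (a := 0) (b := t) (fun _ => hK)
      (fun s _ => (hα s).continuousAt.continuousWithinAt) (fun s _ => (hα s).hasDerivWithinAt)
      (fun s _ => (hβ s).continuousAt.continuousWithinAt) (fun s _ => (hβ s).hasDerivWithinAt)
      le_rfl t ⟨ht, le_rfl⟩
    simpa using this
  rcases le_total 0 t with ht | ht
  · rw [abs_of_nonneg ht]
    exact forward hK hα hβ t ht
  · have reverse {α : ℝ → E} (hα : ∀ t, HasDerivAt α (f (α t)) t) (s : ℝ) :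
        HasDerivAt (fun s => α (-s)) (-f (α (-s))) s := by
      simpa [Function.comp_def] using (hα (-s)).scomp s (hasDerivAt_neg s)
    have := forward (f := fun x => -f x) hK.neg (reverse hα) (reverse hβ) (-t) (by linarith)
    simpa [abs_of_nonpos ht] using this

end IntegralCurves

/-- The phase-plane field of `W'' = -2 k W' + b W (1 - W)`, truncated so that it is
bounded and globally Lipschitz. It is not truncated where `0 ≤ W ≤ 1` and `0 ≤ W' ≤ k`. -/
noncomputable def kppField (k b : ℝ) (p : ℝ × ℝ) : ℝ × ℝ :=
  (max 0 (min k p.2),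
    -2 * k * max 0 (min k p.2) + b * (max 0 (min 1 p.1) * (1 - max 0 (min 1 p.1))))

/-- A trapping region of the phase plane. -/
def kppRegion (k m : ℝ) : Set (ℝ × ℝ) :=
  {p | 0 ≤ p.2 ∧ p.2 + k * p.1 ≤ k ∧ p.2 ≤ m * p.1}

lemma isClosed_kppRegion (k m : ℝ) : IsClosed (kppRegion k m) := by
  have h1 : IsClosed {p : ℝ × ℝ | 0 ≤ p.2} := isClosed_le (by fun_prop) (by fun_prop)
  have h2 : IsClosed {p : ℝ × ℝ | p.2 + k * p.1 ≤ k} := isClosed_le (by fun_prop) (by fun_prop)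
  have h3 : IsClosed {p : ℝ × ℝ | p.2 ≤ m * p.1} := isClosed_le (by fun_prop) (by fun_prop)
  exact h1.inter (h2.inter h3)

lemma abs_clip_sub_clip_le (c x y : ℝ) :
    |max 0 (min c x) - max 0 (min c y)| ≤ |x - y| := by
  have h := ((LipschitzWith.id (α := ℝ)).const_min c).const_max 0 |>.dist_le_mul x y
  simpa [Real.dist_eq] using h

lemma clip_unit_mem (x : ℝ) : 0 ≤ max 0 (min 1 x) ∧ max 0 (min 1 x) ≤ 1 :=
  ⟨le_max_left _ _, max_le zero_le_one (min_le_left _ _)⟩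

section Phase

variable {k b m : ℝ}

lemma lipschitzWith_kppField (hk : 0 ≤ k) (hb : 0 ≤ b) :
    LipschitzWith (1 + 2 * k + b).toNNReal (kppField k b) := by
  refine LipschitzWith.of_dist_le_mul fun p r => ?_
  rw [Real.coe_toNNReal _ (by positivity), Prod.dist_eq (x := kppField k b p), Real.dist_eq,
    Real.dist_eq]
  have h1 : |p.1 - r.1| ≤ dist p r := le_max_left (dist p.1 r.1) _
  have h2 : |p.2 - r.2| ≤ dist p r := le_max_right (dist p.1 r.1) _
  have c1 := (abs_clip_sub_clip_le 1 p.1 r.1).trans h1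
  have c2 := (abs_clip_sub_clip_le k p.2 r.2).trans h2
  have hd : 0 ≤ dist p r := dist_nonneg
  obtain ⟨x0, x1⟩ := clip_unit_mem p.1
  obtain ⟨y0, y1⟩ := clip_unit_mem r.1
  simp only [kppField]
  generalize max 0 (min 1 p.1) = x at *
  generalize max 0 (min 1 r.1) = y at *
  generalize max 0 (min k p.2) = s at *
  generalize max 0 (min k r.2) = t at *
  have c3 : |x * (1 - x) - y * (1 - y)| ≤ dist p r := by
    rw [show x * (1 - x) - y * (1 - y) = (x - y) * (1 - x - y) by ring, abs_mul]
    have : |1 - x - y| ≤ 1 := abs_le.2 ⟨by linarith, by linarith⟩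
    nlinarith [abs_nonneg (x - y)]
  refine max_le ?_ ?_
  · nlinarith [mul_nonneg hk hd, mul_nonneg hb hd]
  · rw [show -2 * k * s + b * (x * (1 - x)) - (-2 * k * t + b * (y * (1 - y)))
      = (-(2 * k)) * (s - t) + b * (x * (1 - x) - y * (1 - y)) by ring]
    refine (abs_add_le _ _).trans ?_
    rw [abs_mul, abs_mul, abs_neg, abs_of_nonneg hb, abs_of_nonneg (by positivity : 0 ≤ 2 * k)]
    nlinarith [mul_le_mul_of_nonneg_left c2 hk, mul_le_mul_of_nonneg_left c3 hb]

lemma norm_kppField_le (hk : 0 ≤ k) (hb : 0 ≤ b) (p : ℝ × ℝ) :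
    ‖kppField k b p‖ ≤ (k + 2 * k * k + b).toNNReal := by
  rw [Real.coe_toNNReal _ (by positivity), Prod.norm_def, Real.norm_eq_abs, Real.norm_eq_abs]
  have s0 : 0 ≤ max 0 (min k p.2) := le_max_left _ _
  have s1 : max 0 (min k p.2) ≤ k := max_le hk (min_le_left _ _)
  obtain ⟨x0, x1⟩ := clip_unit_mem p.1
  simp only [kppField]
  generalize max 0 (min 1 p.1) = x at *
  generalize max 0 (min k p.2) = s at *
  have hx0 : 0 ≤ x * (1 - x) := mul_nonneg x0 (by linarith)
  have hx1 : x * (1 - x) ≤ 1 := by nlinarith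
  have h1 := mul_nonneg hb hx0
  have h2 := mul_le_mul_of_nonneg_left hx1 hb
  have h3 := mul_le_mul_of_nonneg_left s1 hk
  have h4 := mul_nonneg hk s0
  have h5 := mul_nonneg hk hk
  refine max_le (abs_le.2 ⟨?_, ?_⟩) (abs_le.2 ⟨?_, ?_⟩) <;> nlinarith

lemma exists_kppField_curve (hk : 0 ≤ k) (hb : 0 ≤ b) (p : ℝ × ℝ) :
    ∃ α : ℝ → ℝ × ℝ, α 0 = p ∧ ∀ t, HasDerivAt α (kppField k b (α t)) t :=
  exists_forall_hasDerivAt_of_lipschitzWith (lipschitzWith_kppField hk hb)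
    (norm_kppField_le hk hb) p

lemma mem_Icc_of_mem_kppRegion (hk : 0 < k) (hm : 0 < m) {p : ℝ × ℝ} (hp : p ∈ kppRegion k m) :
    p.1 ∈ Set.Icc (0 : ℝ) 1 ∧ p.2 ∈ Set.Icc 0 k := by
  obtain ⟨h1, h2, h3⟩ := hp
  have h0 : 0 ≤ p.1 := nonneg_of_mul_nonneg_right (h1.trans h3) hm
  have h4 : k * p.1 ≤ k * 1 := by linarith
  exact ⟨⟨h0, le_of_mul_le_mul_left h4 hk⟩, h1, by nlinarith⟩

lemma kppField_eq {p : ℝ × ℝ} (h1 : p.1 ∈ Set.Icc (0 : ℝ) 1) (h2 : p.2 ∈ Set.Icc 0 k) :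
    kppField k b p = (p.2, -2 * k * p.2 + b * (p.1 * (1 - p.1))) := by
  rw [kppField, min_eq_right h1.2, max_eq_right h1.1, min_eq_right h2.2, max_eq_right h2.1]

variable {α : ℝ → ℝ × ℝ}

lemma hasDerivAt_fst_of_pair {p : ℝ × ℝ} {t : ℝ} (h : HasDerivAt α p t) :
    HasDerivAt (fun t => (α t).1) p.1 t :=
  (ContinuousLinearMap.fst ℝ ℝ ℝ).hasFDerivAt.comp_hasDerivAt t h

lemma hasDerivAt_snd_of_pair {p : ℝ × ℝ} {t : ℝ} (h : HasDerivAt α p t) :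
    HasDerivAt (fun t => (α t).2) p.2 t :=
  (ContinuousLinearMap.snd ℝ ℝ ℝ).hasFDerivAt.comp_hasDerivAt t h

lemma monotone_fst_of_kppField (hα : ∀ t, HasDerivAt α (kppField k b (α t)) t) :
    Monotone fun t => (α t).1 :=
  monotone_of_hasDerivAt_nonneg (fun t => hasDerivAt_fst_of_pair (hα t)) fun _ => le_max_left _ _

lemma mem_kppRegion_of_le (hk : 0 < k) (hb : 0 < b) (hbk : b ≤ k ^ 2) (hm : 0 < m)
    (hmb : m ^ 2 + 2 * k * m = b) (hα : ∀ t, HasDerivAt α (kppField k b (α t)) t) {t₀ : ℝ}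
    (h₀ : α t₀ ∈ kppRegion k m) {t : ℝ} (ht : t₀ ≤ t) : α t ∈ kppRegion k m := by
  have hW (t) := hasDerivAt_fst_of_pair (hα t)
  have hQ (t) := hasDerivAt_snd_of_pair (hα t)
  have hw0 : ∀ t, t₀ ≤ t → 0 ≤ (α t).1 := fun t ht =>
    (mem_Icc_of_mem_kppRegion hk hm h₀).1.1.trans (monotone_fst_of_kppField hα ht)
  have hq0 : ∀ t, t₀ ≤ t → 0 ≤ (α t).2 := by
    intro t ht
    have := nonpos_of_deriv_nonpos_of_pos (fun t => (hQ t).fun_neg) (a := t₀)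
      (by simpa using h₀.1) (fun t _ hpos => ?_) t ht
    · simpa using this
    · have hneg : (α t).2 ≤ 0 := by simp at hpos; exact hpos.le
      obtain ⟨x0, x1⟩ := clip_unit_mem (α t).1
      simp only [kppField, max_eq_left ((min_le_right k _).trans hneg)]
      have := mul_nonneg hb.le (mul_nonneg x0 (sub_nonneg.2 x1))
      linarith
  have htri : ∀ t, t₀ ≤ t → (α t).2 + k * (α t).1 - k ≤ 0 := by
    refine nonpos_of_deriv_nonpos_of_pos
      (fun t => ((hQ t).add ((hW t).const_mul k)).sub_const k) (by linarith [h₀.2.1]) ?_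
    intro t ht hpos
    have hw := hw0 t ht
    have hq := hq0 t ht
    simp only [kppField]
    rcases le_total (α t).1 1 with h1 | h1
    · have hs : k * (1 - (α t).1) ≤ max 0 (min k (α t).2) :=
        le_max_of_le_right (le_min (by nlinarith) (by simp at hpos; linarith))
      rw [min_eq_right h1, max_eq_right hw]
      generalize max 0 (min k (α t).2) = s at *
      generalize (α t).1 = w at *
      have e1 : b * (w * (1 - w)) ≤ k ^ 2 * (1 - w) := by
        have : w * (1 - w) ≤ 1 - w := by nlinarith
        have h0 : 0 ≤ 1 - w := by linarith
        nlinarith [mul_le_mul_of_nonneg_left this hb.le]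
      nlinarith
    · rw [min_eq_left h1, max_eq_right zero_le_one]
      have : 0 ≤ max 0 (min k (α t).2) := le_max_left _ _
      nlinarith
  have hcone : ∀ t, t₀ ≤ t → (α t).2 - m * (α t).1 ≤ 0 := by
    refine nonpos_of_deriv_nonpos_of_pos
      (fun t => (hQ t).sub ((hW t).const_mul m)) (by linarith [h₀.2.2]) ?_
    intro t ht hpos
    have hw := hw0 t ht
    have hq := hq0 t ht
    have ht1 := htri t ht
    have hw1 : k * (α t).1 ≤ k * 1 := by linarith
    rw [kppField_eq ⟨hw, le_of_mul_le_mul_left hw1 hk⟩ ⟨hq, by nlinarith⟩]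
    simp only [sub_pos] at hpos ⊢
    generalize (α t).1 = w at *
    generalize (α t).2 = q at *
    subst hmb
    have h2 : (2 * k + m) * (m * w) ≤ (2 * k + m) * q :=
      mul_le_mul_of_nonneg_left hpos.le (by positivity)
    nlinarith [mul_nonneg hb.le (mul_self_nonneg w)]
  exact ⟨hq0 t ht, by linarith [htri t ht], by linarith [hcone t ht]⟩

/-- A trajectory cannot stay for long where `W (1 - W)` is bounded away from zero. -/
lemma mul_sub_le_of_mem_kppRegion (hk : 0 < k) (hm : 0 < m) (hb : 0 < b)
    (hα : ∀ t, HasDerivAt α (kppField k b (α t)) t) {s t δ : ℝ} (hst : s ≤ t)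
    (hR : ∀ x ∈ Set.Icc s t, α x ∈ kppRegion k m)
    (hδ : ∀ x ∈ Set.Icc s t, δ ≤ (α x).1 * (1 - (α x).1)) : b * δ * (t - s) ≤ 3 * k := by
  have hd (x) := (hasDerivAt_snd_of_pair (hα x)).add ((hasDerivAt_fst_of_pair (hα x)).const_mul (2 * k))
  have key := (convex_Icc s t).mul_sub_le_image_sub_of_le_deriv (C := b * δ)
    (fun x _ => (hd x).continuousAt.continuousWithinAt)
    (fun x _ => (hd x).differentiableAt.differentiableWithinAt) (fun x hx => ?_)
    s ⟨le_rfl, hst⟩ t ⟨hst, le_rfl⟩ hst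
  · obtain ⟨⟨a1, a2⟩, a3, a4⟩ := mem_Icc_of_mem_kppRegion hk hm (hR s ⟨le_rfl, hst⟩)
    obtain ⟨⟨b1, b2⟩, b3, b4⟩ := mem_Icc_of_mem_kppRegion hk hm (hR t ⟨hst, le_rfl⟩)
    simp only [Pi.add_apply] at key
    nlinarith
  · have hx' := interior_subset hx
    obtain ⟨h1, h2⟩ := mem_Icc_of_mem_kppRegion hk hm (hR x hx')
    rw [(hd x).deriv, kppField_eq h1 h2]
    have := mul_le_mul_of_nonneg_left (hδ x hx') hb.le
    linarith

lemma exists_lt_of_stay (hk : 0 < k) (hb : 0 < b) {δ : ℝ} (hδ : 0 < δ) :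
    ∃ T : ℝ, 0 ≤ T ∧ 3 * k < b * δ * T := by
  have hbδ : 0 < b * δ := mul_pos hb hδ
  refine ⟨3 * k / (b * δ) + 1, by positivity, ?_⟩
  rw [mul_add, mul_div_cancel₀ _ hbδ.ne']
  linarith

/-- Trajectories through the line `W = 1/2` staying in the trapping region from an arbitrarily
early time on. -/
lemma exists_curve_mem_kppRegion (hk : 0 < k) (hb : 0 < b) (hbk : b ≤ k ^ 2) (hm : 0 < m)
    (hmb : m ^ 2 + 2 * k * m = b) (n : ℕ) :
    ∃ α : ℝ → ℝ × ℝ, (∀ t, HasDerivAt α (kppField k b (α t)) t) ∧ (α 0).1 = 1 / 2 ∧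
      ∀ t, -(n : ℝ) ≤ t → α t ∈ kppRegion k m := by
  set ε : ℝ := Real.exp (-(m * n)) / 2 with hε
  have hε0 : 0 < ε := by positivity
  have hε1 : ε ≤ 1 / 2 := by
    have : Real.exp (-(m * n)) ≤ 1 := Real.exp_le_one_iff.2 (by simp; positivity)
    linarith
  obtain ⟨α, hα0, hα⟩ := exists_kppField_curve hk.le hb.le (ε, 0)
  have hmono := monotone_fst_of_kppField hα
  have hR (t : ℝ) (ht : 0 ≤ t) : α t ∈ kppRegion k m := by
    refine mem_kppRegion_of_le hk hb hbk hm hmb hα ?_ ht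
    rw [hα0]
    exact ⟨le_rfl, by simp only; nlinarith, by simp only; positivity⟩
  have hge (t : ℝ) (ht : 0 ≤ t) : ε ≤ (α t).1 := by simpa [hα0] using hmono ht
  obtain ⟨S, hS0, hS⟩ : ∃ S : ℝ, 0 ≤ S ∧ 1 / 2 ≤ (α S).1 := by
    by_contra! hlt
    obtain ⟨T, hT0, hT⟩ := exists_lt_of_stay hk hb (half_pos hε0)
    refine hT.not_ge ?_
    have := mul_sub_le_of_mem_kppRegion (δ := ε / 2) hk hm hb hα hT0 (fun x hx => hR x hx.1)
      fun x hx => by nlinarith [hge x hx.1, hlt x hx.1]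
    simpa using this
  have hcont : Continuous fun t => (α t).1 :=
    continuous_iff_continuousAt.2 fun t => (hasDerivAt_fst_of_pair (hα t)).continuousAt
  obtain ⟨T, ⟨hT0, -⟩, hT⟩ := intermediate_value_Icc hS0 hcont.continuousOn
    (show (1 / 2 : ℝ) ∈ Set.Icc _ _ from ⟨by simpa [hα0] using hε1, hS⟩)
  have hnT : (n : ℝ) ≤ T := by
    have hd (t : ℝ) := (hasDerivAt_fst_of_pair (hα t)).mul (((hasDerivAt_id t).const_mul (-m)).exp)
    have hanti : AntitoneOn (fun t => (α t).1 * Real.exp (-m * t)) (Set.Icc 0 T) := by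
      refine antitoneOn_of_deriv_nonpos (convex_Icc 0 T)
        (fun t _ => (hd t).continuousAt.continuousWithinAt)
        (fun t _ => (hd t).differentiableAt.differentiableWithinAt) fun t ht => ?_
      have hRt := hR t (interior_subset ht).1
      obtain ⟨h1, h2⟩ := mem_Icc_of_mem_kppRegion hk hm hRt
      refine (hd t).deriv.trans_le ?_
      rw [kppField_eq h1 h2]
      have := mul_nonneg (sub_nonneg.2 hRt.2.2) (Real.exp_pos (-m * t)).le
      simp only [id]
      linarith
    have h := hanti ⟨le_rfl, hT0⟩ ⟨hT0, le_rfl⟩ hT0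
    simp only [hα0, hε] at h hT
    rw [hT] at h
    simp only [mul_zero, Real.exp_zero, mul_one] at h
    have h' : -m * T ≤ -(m * n) := Real.exp_le_exp.1 (by linarith)
    exact le_of_mul_le_mul_left (by linarith) hm
  refine ⟨fun t => α (t + T), fun t => (hα (t + T)).comp_add_const t T, by simpa using hT, ?_⟩
  exact fun t ht => hR _ (by linarith)

lemma exists_curve_forall_mem_kppRegion (hk : 0 < k) (hb : 0 < b) (hbk : b ≤ k ^ 2) (hm : 0 < m)
    (hmb : m ^ 2 + 2 * k * m = b) :
    ∃ α : ℝ → ℝ × ℝ, (∀ t, HasDerivAt α (kppField k b (α t)) t) ∧ (α 0).1 = 1 / 2 ∧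
      ∀ t, α t ∈ kppRegion k m := by
  choose β hβ hβ0 hβR using exists_curve_mem_kppRegion hk hb hbk hm hmb
  have hmem (n : ℕ) : (β n 0).2 ∈ Set.Icc 0 k :=
    (mem_Icc_of_mem_kppRegion hk hm (hβR n 0 (by simp))).2
  obtain ⟨q, -, φ, hφ, hq⟩ := isCompact_Icc.tendsto_subseq hmem
  obtain ⟨α, hα0, hα⟩ := exists_kppField_curve hk.le hb.le (1 / 2, q)
  refine ⟨α, hα, by simp [hα0], fun t => ?_⟩
  have h0 : Tendsto (fun n => β (φ n) 0) atTop (nhds (α 0)) := by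
    rw [hα0]
    exact Tendsto.prodMk_nhds (by simp [hβ0]) hq
  have ht : Tendsto (fun n => β (φ n) t) atTop (nhds (α t)) := by
    rw [tendsto_iff_dist_tendsto_zero] at h0 ⊢
    refine squeeze_zero (fun _ => dist_nonneg) (fun n => dist_le_dist_mul_exp_of_lipschitzWith
      (lipschitzWith_kppField hk.le hb.le) (hβ (φ n)) hα t) ?_
    simpa using h0.mul_const (Real.exp ((1 + 2 * k + b).toNNReal * |t|))
  refine (isClosed_kppRegion k m).mem_of_tendsto ht ?_
  filter_upwards [tendsto_natCast_atTop_atTop.eventually_ge_atTop (-t)] with n hn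
  have : (n : ℝ) ≤ φ n := by exact_mod_cast hφ.id_le n
  exact hβR (φ n) t (by linarith)

/-- A heteroclinic solution of `W'' = -2 k W' + b W (1 - W)` connecting `0` to `1`. -/
lemma exists_heteroclinic (hk : 0 < k) (hb : 0 < b) (hbk : b ≤ k ^ 2) :
    ∃ W Q : ℝ → ℝ, (∀ t, HasDerivAt W (Q t) t) ∧
      (∀ t, HasDerivAt Q (-2 * k * Q t + b * (W t * (1 - W t))) t) ∧
      (∀ t, W t ∈ Set.Icc (0 : ℝ) 1) ∧ Tendsto W atBot (nhds 0) ∧ Tendsto W atTop (nhds 1) ∧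
      Tendsto Q atBot (nhds 0) ∧ Tendsto Q atTop (nhds 0) := by
  obtain ⟨m, hm, hmb⟩ : ∃ m : ℝ, 0 < m ∧ m ^ 2 + 2 * k * m = b := by
    refine ⟨√(k ^ 2 + b) - k, sub_pos.2 (Real.lt_sqrt_of_sq_lt (by linarith)), ?_⟩
    linear_combination Real.sq_sqrt (show 0 ≤ k ^ 2 + b by positivity)
  obtain ⟨α, hα, hα0, hR⟩ := exists_curve_forall_mem_kppRegion hk hb hbk hm hmb
  have hI (t) := mem_Icc_of_mem_kppRegion hk hm (hR t)
  have hmono := monotone_fst_of_kppField hα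
  have hbot : Tendsto (fun t => (α t).1) atBot (nhds 0) := by
    refine tendsto_order.2 ⟨fun a ha => Eventually.of_forall fun t => ha.trans_le (hI t).1.1,
      fun a ha => ?_⟩
    obtain ⟨s, hs⟩ : ∃ s, (α s).1 < a := by
      by_contra! hge
      obtain ⟨T, hT0, hT⟩ := exists_lt_of_stay hk hb (half_pos ha)
      refine hT.not_ge ?_
      have := mul_sub_le_of_mem_kppRegion (s := -T) (t := 0) (δ := a / 2) hk hm hb hα
        (by linarith) (fun x _ => hR x) fun x hx => by
          have : (α x).1 ≤ 1 / 2 := (hmono hx.2).trans hα0.le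
          nlinarith [hge x]
      simpa using this
    filter_upwards [eventually_le_atBot s] with t ht using (hmono ht).trans_lt hs
  have htop : Tendsto (fun t => (α t).1) atTop (nhds 1) := by
    refine tendsto_order.2 ⟨fun a ha => ?_,
      fun a ha => Eventually.of_forall fun t => (hI t).1.2.trans_lt ha⟩
    obtain ⟨s, hs⟩ : ∃ s, a < (α s).1 := by
      by_contra! hle
      obtain ⟨T, hT0, hT⟩ := exists_lt_of_stay hk hb (half_pos (sub_pos.2 ha))
      refine hT.not_ge ?_
      have := mul_sub_le_of_mem_kppRegion (s := 0) (t := T) (δ := (1 - a) / 2) hk hm hb hα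
        hT0 (fun x _ => hR x) fun x hx => by
          have : 1 / 2 ≤ (α x).1 := hα0.ge.trans (hmono hx.1)
          nlinarith [hle x]
      simpa using this
    filter_upwards [eventually_ge_atTop s] with t ht using hs.trans_le (hmono ht)
  refine ⟨fun t => (α t).1, fun t => (α t).2, fun t => ?_, fun t => ?_, fun t => (hI t).1,
    hbot, htop, ?_, ?_⟩
  · simpa only [kppField_eq (hI t).1 (hI t).2] using hasDerivAt_fst_of_pair (hα t)
  · simpa only [kppField_eq (hI t).1 (hI t).2] using hasDerivAt_snd_of_pair (hα t)
  · exact squeeze_zero (fun t => (hI t).2.1) (fun t => (hR t).2.2) (by simpa using hbot.const_mul m)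
  · exact squeeze_zero (fun t => (hI t).2.1)
      (fun t => show (α t).2 ≤ k - k * (α t).1 by linarith [(hR t).2.1])
      (by simpa using (htop.const_mul k).const_sub k)

end Phase

section Waves

variable {γ μ v : ℝ} {w w₁ w₂ : ℝ → ℝ}

lemma ContDiff.hasDerivAt_of_two (h : ContDiff ℝ 2 w) (x : ℝ) : HasDerivAt w (deriv w x) x :=
  (h.differentiable (by norm_num) x).hasDerivAt

lemma ContDiff.hasDerivAt_deriv_of_two (h : ContDiff ℝ 2 w) (x : ℝ) :
    HasDerivAt (deriv w) (deriv (deriv w) x) x :=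
  (h.differentiable_deriv_two x).hasDerivAt

lemma lipschitzOnWith_kpp_phase (A B : ℝ) :
    LipschitzOnWith (1 + |A| + |B|).toNNReal
      (fun p : ℝ × ℝ => (p.2, A * p.2 + B * (p.1 ^ 2 - p.1))) {p | p.1 ∈ Set.Icc (0 : ℝ) 1} := by
  refine LipschitzOnWith.of_dist_le_mul fun p hp r hr => ?_
  obtain ⟨p, p'⟩ := p
  obtain ⟨r, r'⟩ := r
  rw [Real.coe_toNNReal _ (by positivity),
    Prod.dist_eq (x := (p', A * p' + B * (p ^ 2 - p))), Real.dist_eq, Real.dist_eq]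
  have h1 : |p - r| ≤ dist (p, p') (r, r') := le_max_left (dist p r) _
  have h2 : |p' - r'| ≤ dist (p, p') (r, r') := le_max_right (dist p r) _
  generalize dist (p, p') (r, r') = d at *
  obtain ⟨p0, p1⟩ : 0 ≤ p ∧ p ≤ 1 := hp
  obtain ⟨r0, r1⟩ : 0 ≤ r ∧ r ≤ 1 := hr
  have hd : 0 ≤ d := (abs_nonneg _).trans h1
  have h3 : |p ^ 2 - p - (r ^ 2 - r)| ≤ d := by
    rw [show p ^ 2 - p - (r ^ 2 - r) = (p - r) * (p + r - 1) by ring, abs_mul]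
    have : |p + r - 1| ≤ 1 := abs_le.2 ⟨by linarith, by linarith⟩
    nlinarith [abs_nonneg (p - r)]
  have hA := mul_le_mul_of_nonneg_left h2 (abs_nonneg A)
  have hB := mul_le_mul_of_nonneg_left h3 (abs_nonneg B)
  refine max_le ?_ ?_
  · nlinarith [mul_nonneg (abs_nonneg A) hd, mul_nonneg (abs_nonneg B) hd]
  · simp only
    rw [show A * p' + B * (p ^ 2 - p) - (A * r' + B * (r ^ 2 - r))
      = A * (p' - r') + B * (p ^ 2 - p - (r ^ 2 - r)) by ring]
    refine (abs_add_le _ _).trans ?_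
    rw [abs_mul, abs_mul]
    linarith

/-- Uniqueness for the initial value problem of the travelling-wave equation. -/
lemma eq_of_kpp_of_eq_of_deriv_eq (hγ : γ ≠ 0) (h₁ : ContDiff ℝ 2 w₁) (h₂ : ContDiff ℝ 2 w₂)
    (hr₁ : ∀ x, w₁ x ∈ Set.Icc (0 : ℝ) 1) (hr₂ : ∀ x, w₂ x ∈ Set.Icc (0 : ℝ) 1)
    (ho₁ : ∀ x, γ * deriv (deriv w₁) x + v * deriv w₁ x + μ * (w₁ x ^ 2 - w₁ x) = 0)
    (ho₂ : ∀ x, γ * deriv (deriv w₂) x + v * deriv w₂ x + μ * (w₂ x ^ 2 - w₂ x) = 0) {x₀ : ℝ}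
    (h : w₁ x₀ = w₂ x₀) (hd : deriv w₁ x₀ = deriv w₂ x₀) : w₁ = w₂ := by
  have key {w : ℝ → ℝ} (h : ContDiff ℝ 2 w)
      (ho : ∀ x, γ * deriv (deriv w) x + v * deriv w x + μ * (w x ^ 2 - w x) = 0) (x : ℝ) :
      HasDerivAt (fun x => (w x, deriv w x))
        (deriv w x, -v / γ * deriv w x + -μ / γ * (w x ^ 2 - w x)) x := by
    refine (h.hasDerivAt_of_two x).prodMk ?_
    have e : deriv (deriv w) x = -v / γ * deriv w x + -μ / γ * (w x ^ 2 - w x) := by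
      field_simp
      linarith [ho x]
    exact e ▸ h.hasDerivAt_deriv_of_two x
  have := ODE_solution_unique_univ
    (fun _ : ℝ => lipschitzOnWith_kpp_phase (-v / γ) (-μ / γ)) (fun x => ⟨key h₁ ho₁ x, hr₁ x⟩)
    (fun x => ⟨key h₂ ho₂ x, hr₂ x⟩) (t₀ := x₀) (by simp only [h, hd])
  exact funext fun x => congrArg Prod.fst (congrFun this x)

/-- Maximum principle: the travelling-wave equation is monotone where the profile is small. -/
lemma le_of_kpp_of_small (hγ : 0 < γ) (hμ : 0 < μ) (h₁ : ContDiff ℝ 2 w₁)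
    (h₂ : ContDiff ℝ 2 w₂)
    (ho₁ : ∀ x, γ * deriv (deriv w₁) x + v * deriv w₁ x + μ * (w₁ x ^ 2 - w₁ x) = 0)
    (ho₂ : ∀ x, γ * deriv (deriv w₂) x + v * deriv w₂ x + μ * (w₂ x ^ 2 - w₂ x) = 0)
    (hl₁ : Tendsto w₁ atTop (nhds 0)) (hl₂ : Tendsto w₂ atTop (nhds 0)) (h0 : w₁ 0 = w₂ 0)
    (hs : ∀ x, 0 ≤ x → w₁ x ≤ 1 / 4) : ∀ x, 0 ≤ x → w₁ x ≤ w₂ x := by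
  intro x hx
  by_contra! hlt
  have hlim : Tendsto (fun x => w₁ x - w₂ x) atTop (nhds 0) := by simpa using hl₁.sub hl₂
  obtain ⟨X, hX, hxX⟩ := ((hlim.eventually_lt_const (sub_pos.2 hlt)).and
    (eventually_ge_atTop x)).exists
  have hcont : Continuous fun x => w₁ x - w₂ x := h₁.continuous.sub h₂.continuous
  obtain ⟨y, hy, hmax⟩ := isCompact_Icc.exists_isMaxOn ⟨x, hx, hxX⟩ hcont.continuousOn
  have hxy : w₁ x - w₂ x ≤ w₁ y - w₂ y := hmax ⟨hx, hxX⟩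
  have hy0 : 0 < y := hy.1.lt_of_ne fun h => by
    rw [← h, h0] at hxy
    linarith
  have hyX : y < X := hy.2.lt_of_ne fun h => by
    rw [h] at hxy
    linarith
  have hloc : IsLocalMax (fun x => w₁ x - w₂ x) y := hmax.isLocalMax (Icc_mem_nhds hy0 hyX)
  have hd1 : deriv (fun x => w₁ x - w₂ x) = fun x => deriv w₁ x - deriv w₂ x := funext fun x =>
    ((h₁.hasDerivAt_of_two x).sub (h₂.hasDerivAt_of_two x)).deriv
  have hd2 : deriv (deriv fun x => w₁ x - w₂ x) y = deriv (deriv w₁) y - deriv (deriv w₂) y := by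
    rw [hd1]
    exact ((h₁.hasDerivAt_deriv_of_two y).sub (h₂.hasDerivAt_deriv_of_two y)).deriv
  have hzero := hloc.deriv_eq_zero
  have hpos : 0 < deriv (deriv fun x => w₁ x - w₂ x) y := by
    rw [hd2]
    have hz : deriv w₁ y = deriv w₂ y := by
      rw [hd1] at hzero
      linarith
    have e1 := ho₁ y
    have e2 := ho₂ y
    rw [hz] at e1
    have hp : 0 < μ * ((w₁ y - w₂ y) * (1 - w₁ y - w₂ y)) :=
      mul_pos hμ (mul_pos (by linarith) (by linarith [hs y hy0.le]))
    refine pos_of_mul_pos_right (b := deriv (deriv w₁) y - deriv (deriv w₂) y) ?_ hγ.le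
    nlinarith
  have hmin := isLocalMin_of_deriv_deriv_pos hpos hzero hcont.continuousAt
  have hconst : (fun x => w₁ x - w₂ x) =ᶠ[nhds y] fun _ => w₁ y - w₂ y := by
    filter_upwards [hloc, hmin] with z h1 h2 using le_antisymm h1 h2
  rw [hconst.deriv.deriv_eq] at hpos
  simp at hpos

lemma IsKPPWave.comp_add_const (h : IsKPPWave γ μ v w) (a : ℝ) :
    IsKPPWave γ μ v fun x => w (x + a) := by
  obtain ⟨hc, hr, h1, h2, h3, h4, ho⟩ := h
  have hd (f : ℝ → ℝ) : deriv (fun x => f (x + a)) = fun x => deriv f (x + a) :=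
    funext fun x => deriv_comp_add_const f a x
  have hbot := tendsto_atBot_add_const_right atBot a tendsto_id
  have htop := tendsto_atTop_add_const_right atTop a tendsto_id
  refine ⟨hc.comp (contDiff_id.add contDiff_const), fun x => hr _, h1.comp hbot, h2.comp htop,
    ?_, ?_, fun x => ?_⟩
  · rw [hd]
    exact h3.comp hbot
  · rw [hd]
    exact h4.comp htop
  · rw [hd, hd]
    exact ho (x + a)

lemma IsKPPWave.exists_last_eq (h : IsKPPWave γ μ v w) :
    ∃ a, w a = 1 / 4 ∧ ∀ x, a ≤ x → w x ≤ 1 / 4 := by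
  obtain ⟨hc, -, h1, h2, -⟩ := h
  set S : Set ℝ := {x | 1 / 4 ≤ w x}
  have hne : S.Nonempty := by
    obtain ⟨x, hx⟩ := (h1.eventually_const_lt (show (1 / 4 : ℝ) < 1 by norm_num)).exists
    exact ⟨x, hx.le⟩
  have hbdd : BddAbove S := by
    obtain ⟨X, hX⟩ :=
      eventually_atTop.1 (h2.eventually_lt_const (show (0 : ℝ) < 1 / 4 by norm_num))
    exact ⟨X, fun x hx => le_of_not_ge fun hXx => (hX x hXx).not_ge hx⟩
  have hclosed : IsClosed S := isClosed_le continuous_const hc.continuous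
  have hgt (x : ℝ) (hx : sSup S < x) : w x < 1 / 4 := by
    by_contra! hle
    exact hx.not_ge (le_csSup hbdd hle)
  have hle : w (sSup S) ≤ 1 / 4 := by
    refine le_of_tendsto ((hc.continuous.tendsto (sSup S)).mono_left
      (nhdsWithin_le_nhds (s := Set.Ioi (sSup S)))) ?_
    filter_upwards [self_mem_nhdsWithin] with x hx using (hgt x hx).le
  refine ⟨sSup S, le_antisymm hle (hclosed.csSup_mem hne hbdd), fun x hx => ?_⟩
  rcases hx.eq_or_lt with rfl | hx
  · exact hle
  · exact (hgt x hx).le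

lemma IsKPPWave.eq_of_normalized (hγ : 0 < γ) (hμ : 0 < μ) (h₁ : IsKPPWave γ μ v w₁)
    (h₂ : IsKPPWave γ μ v w₂) (h0 : w₁ 0 = w₂ 0)
    (hs₁ : ∀ x, 0 ≤ x → w₁ x ≤ 1 / 4) (hs₂ : ∀ x, 0 ≤ x → w₂ x ≤ 1 / 4) : w₁ = w₂ := by
  obtain ⟨hc₁, hr₁, -, hl₁, -, -, ho₁⟩ := h₁
  obtain ⟨hc₂, hr₂, -, hl₂, -, -, ho₂⟩ := h₂
  have heq (x : ℝ) (hx : 0 ≤ x) : w₁ x = w₂ x :=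
    le_antisymm (le_of_kpp_of_small hγ hμ hc₁ hc₂ ho₁ ho₂ hl₁ hl₂ h0 hs₁ x hx)
      (le_of_kpp_of_small hγ hμ hc₂ hc₁ ho₂ ho₁ hl₂ hl₁ h0.symm hs₂ x hx)
  have hev : w₁ =ᶠ[nhds 1] w₂ := by
    filter_upwards [eventually_ge_nhds (zero_lt_one (α := ℝ))] with x hx using heq x hx
  exact eq_of_kpp_of_eq_of_deriv_eq hγ.ne' hc₁ hc₂ hr₁ hr₂ ho₁ ho₂ hev.eq_of_nhds hev.deriv_eq

lemma IsKPPWave.exists_translate (hγ : 0 < γ) (hμ : 0 < μ) (h₁ : IsKPPWave γ μ v w₁)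
    (h₂ : IsKPPWave γ μ v w₂) : ∃ c : ℝ, ∀ x : ℝ, w₁ x = w₂ (x - c) := by
  obtain ⟨a₁, ha₁, hs₁⟩ := h₁.exists_last_eq
  obtain ⟨a₂, ha₂, hs₂⟩ := h₂.exists_last_eq
  have := (h₁.comp_add_const a₁).eq_of_normalized hγ hμ (h₂.comp_add_const a₂)
    (by simp [ha₁, ha₂]) (fun x hx => hs₁ _ (by linarith)) (fun x hx => hs₂ _ (by linarith))
  refine ⟨a₁ - a₂, fun x => ?_⟩
  have h := congrFun this (x - a₁)
  simp only [sub_add_cancel] at h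
  rw [h]
  congr 1
  ring

/-- Waves move to the left: the energy `γ w'² / 2 + μ (w³ / 3 - w² / 2)` has to increase. -/
lemma IsKPPWave.speed_neg (hμ : 0 < μ) (h : IsKPPWave γ μ v w) : v < 0 := by
  by_contra! hv
  obtain ⟨hc, -, h1, h2, h3, h4, ho⟩ := h
  set F : ℝ → ℝ := fun x => γ * deriv w x ^ 2 / 2 + μ * (w x ^ 3 / 3 - w x ^ 2 / 2) with hF
  have hd (x : ℝ) : HasDerivAt F (-v * deriv w x ^ 2) x := by
    have e1 := hc.hasDerivAt_of_two x
    have e2 := hc.hasDerivAt_deriv_of_two x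
    refine HasDerivAt.congr_deriv ((((e2.pow 2).const_mul γ).div_const 2).add
      ((((e1.pow 3).div_const 3).sub ((e1.pow 2).div_const 2)).const_mul μ)) ?_
    push_cast
    linear_combination (deriv w x) * ho x
  have hanti : Antitone F := antitone_of_hasDerivAt_nonpos hd fun x => by
    have := mul_nonneg hv (sq_nonneg (deriv w x))
    simpa using this
  have hlim {l : Filter ℝ} {a : ℝ} (hw : Tendsto w l (nhds a))
      (hw' : Tendsto (deriv w) l (nhds 0)) :
      Tendsto F l (nhds (γ * 0 ^ 2 / 2 + μ * (a ^ 3 / 3 - a ^ 2 / 2))) :=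
    (((hw'.pow 2).const_mul γ).div_const 2).add
      ((((hw.pow 3).div_const 3).sub ((hw.pow 2).div_const 2)).const_mul μ)
  have g1 := hanti.le_of_tendsto (hlim h2 h4) 0
  have g2 := hanti.ge_of_tendsto (hlim h1 h3) 0
  norm_num at g1 g2
  linarith

/-- Near the value `1` slow profiles oscillate, so they cannot stay below `1`. -/
lemma IsKPPWave.four_mul_le_sq (hγ : 0 < γ) (hμ : 0 < μ) (h : IsKPPWave γ μ v w) :
    4 * γ * μ ≤ v ^ 2 := by
  by_contra! hlt
  obtain ⟨hc, hr, h1, h2, -, -, ho⟩ := h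
  set b := μ / γ with hb
  set κ := -v / (2 * γ) with hκ
  have hb0 : 0 < b := div_pos hμ hγ
  have hκb : κ ^ 2 < b := by
    rw [hκ, hb, div_pow, div_lt_div_iff₀ (by positivity) hγ]
    nlinarith
  have hode (x : ℝ) : deriv (deriv w) x = 2 * κ * deriv w x - b * (w x ^ 2 - w x) := by
    rw [hκ, hb]
    field_simp
    linarith [ho x]
  set ω := √((b - κ ^ 2) / 2) with hω
  have hω0 : 0 < ω := Real.sqrt_pos.2 (by linarith)
  have hω2 : ω ^ 2 = (b - κ ^ 2) / 2 := Real.sq_sqrt (by linarith)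
  obtain ⟨X, hX⟩ := eventually_atBot.1 (h1.eventually_const_lt
    (show 1 - (b - κ ^ 2) / (2 * b) < 1 by
      have : 0 < (b - κ ^ 2) / (2 * b) := div_pos (by linarith) (by linarith)
      linarith))
  have hsmall (x : ℝ) (hx : x ≤ X) : κ ^ 2 + ω ^ 2 - b * w x ≤ 0 := by
    have := mul_le_mul_of_nonneg_left (hX x hx).le hb0.le
    have e : b * (1 - (b - κ ^ 2) / (2 * b)) = b - (b - κ ^ 2) / 2 := by field_simp
    rw [e] at this
    linarith
  have hone (x : ℝ) (hx : x ≤ X) : w x = 1 := by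
    set a := x - Real.pi / ω with ha
    have hax : a ≤ x := by
      have : 0 < Real.pi / ω := div_pos Real.pi_pos hω0
      linarith
    have hωx : ω * (x - a) = Real.pi := by
      rw [ha, sub_sub_cancel, mul_div_cancel₀ _ hω0.ne']
    set H : ℝ → ℝ := fun t => Real.exp (-κ * t) *
      ((-deriv w t - κ * (1 - w t)) * Real.sin (ω * (t - a))
        - (1 - w t) * (ω * Real.cos (ω * (t - a)))) with hH
    have hd (t : ℝ) : HasDerivAt H (Real.exp (-κ * t) * (Real.sin (ω * (t - a)) *
        ((1 - w t) * (κ ^ 2 + ω ^ 2 - b * w t)))) t := by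
      have e1 := hc.hasDerivAt_of_two t
      have e2 := hc.hasDerivAt_deriv_of_two t
      have e3 := ((hasDerivAt_id t).const_mul (-κ)).exp
      have e4 := ((hasDerivAt_id t).sub_const a).const_mul ω
      refine HasDerivAt.congr_deriv
        (e3.mul (((e2.neg.sub ((e1.const_sub 1).const_mul κ)).mul e4.sin).sub
          ((e1.const_sub 1).mul (e4.cos.const_mul ω)))) ?_
      simp only [Pi.sub_apply, Pi.neg_apply, id, hode t]
      ring
    have hanti : AntitoneOn H (Set.Icc a x) := by
      refine antitoneOn_of_deriv_nonpos (convex_Icc a x)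
        (fun t _ => (hd t).continuousAt.continuousWithinAt)
        (fun t _ => (hd t).differentiableAt.differentiableWithinAt) fun t ht => ?_
      obtain ⟨hat, htx⟩ := interior_subset ht
      rw [(hd t).deriv]
      have hsin : 0 ≤ Real.sin (ω * (t - a)) :=
        Real.sin_nonneg_of_nonneg_of_le_pi (mul_nonneg hω0.le (by linarith))
          (hωx ▸ mul_le_mul_of_nonneg_left (by linarith) hω0.le)
      exact mul_nonpos_of_nonneg_of_nonpos (Real.exp_pos _).le
        (mul_nonpos_of_nonneg_of_nonpos hsin (mul_nonpos_of_nonneg_of_nonpos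
          (sub_nonneg.2 (hr t).2) (hsmall t (htx.trans hx))))
    have hle := hanti ⟨le_rfl, hax⟩ ⟨hax, le_rfl⟩ hax
    simp only [hH, hωx, sub_self, mul_zero, Real.sin_pi, Real.cos_pi, Real.sin_zero,
      Real.cos_zero] at hle
    have pa : 0 ≤ Real.exp (-κ * a) * ((1 - w a) * ω) :=
      mul_nonneg (Real.exp_pos _).le (mul_nonneg (sub_nonneg.2 (hr a).2) hω0.le)
    have px : Real.exp (-κ * x) * ω * (1 - w x) ≤ 0 := by linarith
    have := nonpos_of_mul_nonpos_right px (mul_pos (Real.exp_pos _) hω0)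
    linarith [(hr x).2]
  have hev : w =ᶠ[nhds (X - 1)] fun _ => (1 : ℝ) := by
    filter_upwards [eventually_le_nhds (sub_one_lt X)] with x hx using hone x hx
  have hconst : w = fun _ => (1 : ℝ) :=
    eq_of_kpp_of_eq_of_deriv_eq (γ := γ) (μ := μ) (v := v) hγ.ne' hc contDiff_const hr
      (fun _ => by simp) ho (fun x => by simp) hev.eq_of_nhds hev.deriv_eq
  rw [hconst] at h2
  exact one_ne_zero (tendsto_nhds_unique tendsto_const_nhds h2)

lemma exists_isKPPWave (hγ : 0 < γ) (hμ : 0 < μ) (hv : v < 0) (hsq : 4 * γ * μ ≤ v ^ 2) :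
    ∃ w : ℝ → ℝ, IsKPPWave γ μ v w := by
  obtain ⟨W, Q, hW, hQ, hr, hW0, hW1, hQ0, hQ1⟩ := exists_heteroclinic (k := -v / (2 * γ))
    (b := μ / γ) (div_pos (by linarith) (by linarith)) (div_pos hμ hγ) (by
      rw [div_pow, div_le_div_iff₀ hγ (by positivity)]
      nlinarith)
  have hw (x : ℝ) : HasDerivAt (fun x => W (-x)) (-Q (-x)) x := by
    simpa [Function.comp_def] using (hW (-x)).scomp x (hasDerivAt_neg x)
  have hw' (x : ℝ) : HasDerivAt (fun x => -Q (-x))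
      (-2 * (-v / (2 * γ)) * Q (-x) + μ / γ * (W (-x) * (1 - W (-x)))) x := by
    simpa [Function.comp_def] using ((hQ (-x)).scomp x (hasDerivAt_neg x)).fun_neg
  have hd : deriv (fun x => W (-x)) = fun x => -Q (-x) := funext fun x => (hw x).deriv
  have hd' : deriv (fun x => -Q (-x)) = fun x =>
      -2 * (-v / (2 * γ)) * Q (-x) + μ / γ * (W (-x) * (1 - W (-x))) :=
    funext fun x => (hw' x).deriv
  have hWc : Continuous W := continuous_iff_continuousAt.2 fun t => (hW t).continuousAt
  have hQc : Continuous Q := continuous_iff_continuousAt.2 fun t => (hQ t).continuousAt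
  refine ⟨fun x => W (-x), ?_, fun x => hr (-x), hW1.comp tendsto_neg_atBot_atTop,
    hW0.comp tendsto_neg_atTop_atBot, ?_, ?_, fun x => ?_⟩
  · rw [show (2 : WithTop ℕ∞) = 1 + 1 from one_add_one_eq_two.symm, contDiff_succ_iff_deriv]
    refine ⟨fun x => (hw x).differentiableAt, by simp, ?_⟩
    rw [hd, contDiff_one_iff_deriv]
    refine ⟨fun x => (hw' x).differentiableAt, ?_⟩
    rw [hd']
    fun_prop
  · rw [hd]
    simpa using (hQ1.comp tendsto_neg_atBot_atTop).neg
  · rw [hd]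
    simpa using (hQ0.comp tendsto_neg_atTop_atBot).neg
  · rw [hd, hd']
    field_simp
    ring

end Waves

/-- travelling waves of the KPP equation `u_t = γ u_xx + μ(u² − u)` exist
exactly for speeds `v ≤ v* = −√(4γμ)`, are unique up to translation for each such speed,
and do not exist for `v > v*`. -/
theorem statement17 (γ μ : ℝ) (hγ : 0 < γ) (hμ : 0 < μ) :
    (∀ v : ℝ, v ≤ -Real.sqrt (4 * γ * μ) →
      (∃ w : ℝ → ℝ, IsKPPWave γ μ v w) ∧
      ∀ w₁ w₂ : ℝ → ℝ, IsKPPWave γ μ v w₁ → IsKPPWave γ μ v w₂ →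
        ∃ c : ℝ, ∀ x : ℝ, w₁ x = w₂ (x - c)) ∧
    ∀ v : ℝ, -Real.sqrt (4 * γ * μ) < v → ¬ ∃ w : ℝ → ℝ, IsKPPWave γ μ v w := by
  have hpos : 0 < 4 * γ * μ := by positivity
  refine ⟨fun v hv => ⟨?_, fun w₁ w₂ h₁ h₂ => h₁.exists_translate hγ hμ h₂⟩, ?_⟩
  · have hs := Real.sqrt_pos.2 hpos
    refine exists_isKPPWave hγ hμ (by linarith) ?_
    rw [← neg_sq]
    exact (Real.sqrt_le_left (by linarith : 0 ≤ -v)).1 (by linarith)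
  · rintro v hv ⟨w, h⟩
    have hneg := h.speed_neg hμ
    have := Real.sqrt_le_sqrt (h.four_mul_le_sq hγ hμ)
    rw [Real.sqrt_sq_eq_abs, abs_of_neg hneg] at this
    linarith
end

section
/- Let N ≥ 2 be an integer and let Γ = { y ∈ ℤ_{≥0}^N : min_{1≤i≤N} y_i = 0 }. Define a relation → on Γ: for y, w ∈ Γ, y → w if and only if either (a) w = y + e_i^{(N)} for some i (with w ∈ Γ, i.e. min of w is still 0), or (b) w = y − (y_i − y_j) e_i^{(N)} for some indices i, j with y_i > y_j. Then for every y ∈ Γ there exists a sequence v⁰ = y, v¹, …, v^N = (0,…,0) of elements of Γ such that v^{n−1} → v^n for every n = 1,…,N; that is, the zero configuration is reachable from any state in exactly N allowed transitions. -/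
/-- The state space `Γ` of relative configurations: nonnegative integer vectors whose
minimum equals `0`. -/
def GammaSet (N : ℕ) : Set (Fin N → ℤ) :=
  {y | (∀ i, 0 ≤ y i) ∧ ∃ i, y i = 0}

/-- The allowed transitions of the relative-coordinates Markov chain: (a) a right jump
of one particle keeping the configuration in `Γ`, or (b) a relocation of a particle at a
strictly higher position to the position of a strictly lower one. -/
def Step (N : ℕ) (y w : Fin N → ℤ) : Prop :=
  (∃ i : Fin N, w = y + Pi.single i 1 ∧ w ∈ GammaSet N) ∨
  (∃ i j : Fin N, y j < y i ∧ w = y - (y i - y j) • Pi.single i 1)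

/-- Raising a coordinate by one leaves `GammaSet` invariant as long as another coordinate
vanishes. -/
theorem add_single_mem_GammaSet {N : ℕ} {y : Fin N → ℤ} (hy : ∀ i, 0 ≤ y i) {i z : Fin N}
    (hz : y z = 0) (hne : z ≠ i) : y + Pi.single i 1 ∈ GammaSet N := by
  refine ⟨fun j => add_nonneg (hy j) ?_, z, by simp [hz, hne]⟩
  rcases eq_or_ne j i with rfl | h <;> simp [*]

/-- A path from `y` to the zero configuration with `r` transitions exists as soon as `y` has at
most `r` nonzero coordinates, unless `y = 0` and `r = 1`. -/
theorem exists_path_to_zero {N : ℕ} (hN : 2 ≤ N) (r : ℕ) (y : Fin N → ℤ) (hy : y ∈ GammaSet N)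
    (hr : (Finset.univ.filter fun i => y i ≠ 0).card ≤ r) (h1 : y = 0 → r ≠ 1) :
    ∃ v : ℕ → (Fin N → ℤ),
      v 0 = y ∧ v r = 0 ∧ (∀ n ≤ r, v n ∈ GammaSet N) ∧
      ∀ n < r, Step N (v n) (v (n + 1)) := by
  induction r generalizing y with
  | zero =>
    have h0 : y = 0 := by
      funext i
      simpa using Finset.filter_eq_empty_iff.mp (Finset.card_eq_zero.mp (Nat.le_zero.mp hr))
        (Finset.mem_univ i)
    exact ⟨fun _ => y, rfl, h0, fun _ _ => hy, by simp⟩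
  | succ r ih =>
    suffices h : ∃ w ∈ GammaSet N, Step N y w ∧
        (Finset.univ.filter fun i => w i ≠ 0).card ≤ r ∧ (w = 0 → r ≠ 1) by
      obtain ⟨w, hw, hs, hc, hw1⟩ := h
      obtain ⟨v, hv0, hvr, hvm, hvs⟩ := ih w hw hc hw1
      refine ⟨fun n => n.casesOn y v, rfl, hvr, ?_, ?_⟩
      · rintro (_ | n) hn
        exacts [hy, hvm n (by omega)]
      · rintro (_ | n) hn
        · exact (hv0.symm ▸ hs : Step N y (v 0))
        · exact hvs n (by omega)
    obtain ⟨hnonneg, z, hz⟩ := hy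
    by_cases h0 : y = 0
    · have : Nontrivial (Fin N) := Fin.nontrivial_iff_two_le.mpr hN
      obtain ⟨i, hi⟩ := exists_ne z
      have hmem := add_single_mem_GammaSet hnonneg hz hi.symm
      refine ⟨_, hmem, Or.inl ⟨i, rfl, hmem⟩, ?_, fun h => ?_⟩
      · have hle : (Finset.univ.filter fun j => (y + Pi.single i 1 : Fin N → ℤ) j ≠ 0) ⊆ {i} := by
          intro j hj
          by_contra hji
          simp_all
        have := Finset.card_le_card hle
        have := h1 h0
        simp only [Finset.card_singleton] at *
        omega
      · simpa [h0] using congrFun h i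
    · obtain ⟨i, hi⟩ : ∃ i, y i ≠ 0 := Function.ne_iff.mp h0
      have hipos : 0 < y i := lt_of_le_of_ne (hnonneg i) hi.symm
      have hzi : z ≠ i := by rintro rfl; exact hi hz
      by_cases hlt : (Finset.univ.filter fun i => y i ≠ 0).card ≤ r
      · have hmem := add_single_mem_GammaSet hnonneg hz hzi
        refine ⟨_, hmem, Or.inl ⟨i, rfl, hmem⟩, ?_, fun h => ?_⟩
        · refine (Finset.card_le_card fun j hj => ?_).trans hlt
          rcases eq_or_ne j i with rfl | hji
          · simpa using hi
          · simpa [hji] using hj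
        · have := congrFun h i
          simp only [Pi.add_apply, Pi.single_eq_same, Pi.zero_apply] at this
          omega
      · have hw : y - (y i - y z) • Pi.single i 1 = Function.update y i 0 := by
          funext j
          rcases eq_or_ne j i with rfl | hji <;> simp [*]
        have hcard : (Finset.univ.filter fun j => Function.update y i 0 j ≠ 0).card = r := by
          have : (Finset.univ.filter fun j => Function.update y i 0 j ≠ 0) =
              (Finset.univ.filter fun j => y j ≠ 0).erase i := by
            ext j
            rcases eq_or_ne j i with rfl | hji <;> simp [*]
          rw [this, Finset.card_erase_of_mem (by simpa using hi)]
          omega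
        refine ⟨Function.update y i 0, ⟨fun j => ?_, z, by simp [hzi, hz]⟩,
          Or.inr ⟨i, z, by omega, hw.symm⟩, hcard.le, fun h => ?_⟩
        · rcases eq_or_ne j i with rfl | hji <;> simp [*]
        · simp only [h, Pi.zero_apply, ne_eq, not_true_eq_false, Finset.filter_false,
            Finset.card_empty] at hcard
          omega

/-- from any state `y ∈ Γ` the zero configuration is reachable in exactly
`N` allowed transitions, through states of `Γ`. -/
theorem statement19 (N : ℕ) (hN : 2 ≤ N) (y : Fin N → ℤ) (hy : y ∈ GammaSet N) :
    ∃ v : ℕ → (Fin N → ℤ),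
      v 0 = y ∧ v N = 0 ∧ (∀ n ≤ N, v n ∈ GammaSet N) ∧
      ∀ n < N, Step N (v n) (v (n + 1)) := by
  refine exists_path_to_zero hN N y hy ?_ fun _ => by omega
  simpa using Finset.card_le_univ (Finset.univ.filter fun i => y i ≠ 0)
end
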